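/- arXiv:1702.01377 — 2 statements merged into one kernel-verified Lean document; each statement's English description precedes it below -/
import Mathlib

section
/- (Taylor expansion, third form.) Let k be a nonempty index. Then for z in a neighborhood of 0, F_k(z) = Σ_{m=1}^{∞} (−1)^{m−1} C_m(rev(k∨)) z^m, where k∨ is the Hoffman dual of k and rev denotes reversal of an index. -/
open MeasureTheory Filter Topology

namespace Kawashima

/-- The set `A(k) = {k₁, k₁+k₂, …, k₁+⋯+k_{r-1}}` of proper nonempty partial sums
of an index `k = (k₁, …, k_r)`. -/
def Aset (k : List ℕ) : Finset ℕ :=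
  (Finset.Ico 1 k.length).image (fun i => (k.take i).sum)

/-- The Hoffman dual of an index `k`: the unique index `k∨` with the same weight such
that `A(k)` and `A(k∨)` partition `{1, …, wt(k) - 1}`.  It is computed here as the
composition of `wt(k)` whose partial-sum set is the complement of `A(k)`. -/
def hdual (k : List ℕ) : List ℕ :=
  let w := k.sum
  let L := (insert w ((Finset.Icc 1 (w - 1)) \ Aset k)).sort (· ≤ ·)
  L.zipWith (fun a b => a - b) (0 :: L)

/-- `sStar k N = s⋆(k, N) = Σ_{0 < m₁ ≤ ⋯ ≤ m_{r-1} ≤ m_r = N} 1/(m₁^{k₁} ⋯ m_r^{k_r})`.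
For the empty index the value is `1` (empty product), and for a nonempty index and
`N = 0` the value is `0` (empty sum). -/
noncomputable def sStar (k : List ℕ) (N : ℕ) : ℝ :=
  ∑ m : Fin k.length → Fin (N + 1),
    if (∀ i, 0 < (m i : ℕ)) ∧
       (∀ i j : Fin k.length, i ≤ j → (m i : ℕ) ≤ (m j : ℕ)) ∧
       (∀ i : Fin k.length, (i : ℕ) + 1 = k.length → (m i : ℕ) = N)
    then ∏ i : Fin k.length, 1 / ((m i : ℕ) : ℝ) ^ k.get i
    else 0

/-- `SStar k N = S⋆(k, N) = Σ_{n=1}^N s⋆(k, n)`. -/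
noncomputable def SStar (k : List ℕ) (N : ℕ) : ℝ :=
  ∑ n ∈ Finset.Icc 1 N, sStar k n

/-- The binomial coefficient `binom(z, n) = z(z-1)⋯(z-n+1)/n!` for complex `z`. -/
noncomputable def cbinom (z : ℂ) (n : ℕ) : ℂ :=
  (descPochhammer ℂ n).eval z / (n.factorial : ℂ)

/-- The Kawashima function
`F_k(z) = Σ_{n=1}^∞ (-1)^{n-1} s⋆(k∨, n) binom(z, n)`, with `F_∅(z) = 1`. -/
noncomputable def F (k : List ℕ) (z : ℂ) : ℂ :=
  if k = [] then 1
  else ∑' n : ℕ, (-1 : ℂ) ^ n * ((sStar (hdual k) (n + 1) : ℝ) : ℂ) * cbinom z (n + 1)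

/-- The domain `Δ(k) ⊆ (0,1)^{wt(k)}`: `t_j < t_{j+1}` if `j ∈ A(k)` and
`t_j > t_{j+1}` otherwise (positions `1`-indexed). -/
def Delta (k : List ℕ) : Set (Fin k.sum → ℝ) :=
  {t | (∀ j, t j ∈ Set.Ioo (0 : ℝ) 1) ∧
       ∀ (i : Fin k.sum) (h : (i : ℕ) + 1 < k.sum),
         if (i : ℕ) + 1 ∈ Aset k then t i < t ⟨(i : ℕ) + 1, h⟩
         else t ⟨(i : ℕ) + 1, h⟩ < t i}

/-- The multiple zeta value `ζ(k) = Σ_{0 < m₁ < ⋯ < m_r} 1/(m₁^{k₁} ⋯ m_r^{k_r})`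
(as a `tsum`; it converges for admissible `k`), with `ζ(∅) = 1`. -/
noncomputable def mzv (k : List ℕ) : ℝ :=
  ∑' m : Fin k.length → ℕ,
    if (∀ i, 0 < m i) ∧ (∀ i j : Fin k.length, i < j → m i < m j)
    then ∏ i : Fin k.length, 1 / ((m i : ℕ) : ℝ) ^ k.get i
    else 0

/-- `ζ` extended `ℚ`-linearly to formal `ℚ`-linear combinations of indices. -/
noncomputable def zetaL (v : List ℕ →₀ ℚ) : ℝ :=
  v.sum fun k a => (a : ℝ) * mzv k

/-- The Kawashima function extended `ℚ`-linearly to formal combinations of indices. -/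
noncomputable def FL (v : List ℕ →₀ ℚ) (z : ℂ) : ℂ :=
  v.sum fun k a => (a : ℂ) * F k z

/-- Auxiliary harmonic product, on *reversed* indices (so that the rightmost entry of
the index is the head of the list):
`k * l = (k₋ * l, k_r) + (k * l₋, l_s) + (k₋ * l₋, k_r + l_s)`. -/
noncomputable def hstarAux : List ℕ → List ℕ → (List ℕ →₀ ℚ)
  | [], l => Finsupp.single l 1
  | a :: k, [] => Finsupp.single (a :: k) 1
  | a :: k, b :: l =>
      Finsupp.mapDomain (List.cons a) (hstarAux k (b :: l)) +
      Finsupp.mapDomain (List.cons b) (hstarAux (a :: k) l) +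
      Finsupp.mapDomain (List.cons (a + b)) (hstarAux k l)
  termination_by k l => k.length + l.length

/-- The harmonic product `k * l` of two indices, as a `ℚ`-linear combination of
indices. -/
noncomputable def hstar (k l : List ℕ) : List ℕ →₀ ℚ :=
  Finsupp.mapDomain List.reverse (hstarAux k.reverse l.reverse)

/-- Auxiliary product `*̄` on reversed indices:
`k *̄ l = (k₋ *̄ l, k_r) + (k *̄ l₋, l_s) - (k₋ *̄ l₋, k_r + l_s)`. -/
noncomputable def hbarAux : List ℕ → List ℕ → (List ℕ →₀ ℚ)
  | [], l => Finsupp.single l 1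
  | a :: k, [] => Finsupp.single (a :: k) 1
  | a :: k, b :: l =>
      Finsupp.mapDomain (List.cons a) (hbarAux k (b :: l)) +
      Finsupp.mapDomain (List.cons b) (hbarAux (a :: k) l) -
      Finsupp.mapDomain (List.cons (a + b)) (hbarAux k l)
  termination_by k l => k.length + l.length

/-- The harmonic product `k *̄ l` of two indices. -/
noncomputable def hbar (k l : List ℕ) : List ℕ →₀ ℚ :=
  Finsupp.mapDomain List.reverse (hbarAux k.reverse l.reverse)

/-- The product `k ⊛ l = (k₋ * l₋, k_r + l_s)` for nonempty indices `k`, `l`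
(and `0` if either is empty). -/
noncomputable def circAst (k l : List ℕ) : List ℕ →₀ ℚ :=
  match k.reverse, l.reverse with
  | a :: k', b :: l' =>
      Finsupp.mapDomain List.reverse
        (Finsupp.mapDomain (List.cons (a + b)) (hstarAux k' l'))
  | _, _ => 0

/-- `⊛` extended bilinearly to formal combinations. -/
noncomputable def circAstL (v w : List ℕ →₀ ℚ) : List ℕ →₀ ℚ :=
  v.sum fun k a => w.sum fun l b => (a * b) • circAst k l

/-- The star operator `k ↦ k⋆`: the sum over all ways to replace commas by pluses
in groups of consecutive entries,
`(k₁,…,k_r)⋆ = Σ_{0<j₁<⋯<j_q=r} (k₁+⋯+k_{j₁}, …, k_{j_{q-1}+1}+⋯+k_{j_q})`. -/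
noncomputable def starOp : List ℕ → (List ℕ →₀ ℚ)
  | [] => Finsupp.single [] 1
  | [a] => Finsupp.single [a] 1
  | a :: b :: k =>
      Finsupp.mapDomain (List.cons a) (starOp (b :: k)) + starOp ((a + b) :: k)
  termination_by k => k.length

/-- The star operator extended `ℚ`-linearly. -/
noncomputable def starL (v : List ℕ →₀ ℚ) : List ℕ →₀ ℚ :=
  v.sum fun k a => a • starOp k

open Classical in
/-- Kawashima's function `G_k(z)`: the sum over tuples `0 < n₁, …, n_w` with
`n_j < n_{j+1}` if `j ∉ A(k)` and `n_j ≤ n_{j+1}` if `j ∈ A(k)`, of the product of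
the factors `1/(n_j + z)` at positions `j ∈ A(k)`, the factor
`1/n_w - 1/(n_w + z)` at the last position, and `1/n_j` elsewhere. -/
noncomputable def G (k : List ℕ) (z : ℂ) : ℂ :=
  ∑' n : Fin k.sum → ℕ,
    if (∀ j, 0 < n j) ∧
       (∀ (i : Fin k.sum) (h : (i : ℕ) + 1 < k.sum),
          if (i : ℕ) + 1 ∈ Aset k then n i ≤ n ⟨(i : ℕ) + 1, h⟩
          else n i < n ⟨(i : ℕ) + 1, h⟩)
    then ∏ j : Fin k.sum,
      if (j : ℕ) + 1 = k.sum then 1 / ((n j : ℕ) : ℂ) - 1 / (((n j : ℕ) : ℂ) + z)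
      else if (j : ℕ) + 1 ∈ Aset k then 1 / (((n j : ℕ) : ℂ) + z)
      else 1 / ((n j : ℕ) : ℂ)
    else 0

open Classical in
/-- `ζ_k(l) = Σ 1/(n₁^{l₁} ⋯ n_w^{l_w})`, summed over the same set of tuples as in
the definition of `G_k`. -/
noncomputable def zetaIdx (k : List ℕ) (l : List ℕ) : ℝ :=
  ∑' n : Fin k.sum → ℕ,
    if (∀ j, 0 < n j) ∧
       (∀ (i : Fin k.sum) (h : (i : ℕ) + 1 < k.sum),
          if (i : ℕ) + 1 ∈ Aset k then n i ≤ n ⟨(i : ℕ) + 1, h⟩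
          else n i < n ⟨(i : ℕ) + 1, h⟩)
    then ∏ j : Fin k.sum, 1 / ((n j : ℕ) : ℝ) ^ (l.getD (j : ℕ) 0)
    else 0

/-- `C_m(k) = Σ_{l₁,…,l_{r-1} ≥ 0, l_r ≥ 1, l₁+⋯+l_r = m}
ζ_k(1,…,1 (k₁-1 ones), l₁+1, …, 1,…,1 (k_r-1 ones), l_r+1)`. -/
noncomputable def Cm (k : List ℕ) (m : ℕ) : ℝ :=
  ∑ l : Fin k.length → Fin (m + 1),
    if (∑ i, (l i : ℕ)) = m ∧
       (∀ i : Fin k.length, (i : ℕ) + 1 = k.length → 1 ≤ (l i : ℕ))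
    then zetaIdx k
      ((List.ofFn (fun i : Fin k.length =>
          List.replicate (k.get i - 1) 1 ++ [(l i : ℕ) + 1])).flatten)
    else 0

/-- The iterated integral `A_m(k)` over `Δ((k,1,…,1))` (`m` trailing ones) of
`ω_{δ(1)}(t₁) ⋯ ω_{δ(w-1)}(t_{w-1}) · dt_w/(1-t_w) · dt_{w+1}/t_{w+1} ⋯ dt_{w+m}/t_{w+m}`. -/
noncomputable def Aint (k : List ℕ) (m : ℕ) : ℝ :=
  ∫ t in Delta (k ++ List.replicate m 1),
    ∏ i : Fin (k ++ List.replicate m 1).sum,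
      if (i : ℕ) + 1 < k.sum then
        (if (i : ℕ) + 1 ∈ Aset k then 1 / (1 - t i) else 1 / t i)
      else if (i : ℕ) + 1 = k.sum then 1 / (1 - t i)
      else 1 / t i

/-- The digamma function `ψ(z) = Γ'(z)/Γ(z)`. -/
noncomputable def digamma (z : ℂ) : ℂ := deriv Complex.Gamma z / Complex.Gamma z


open scoped ENNReal

section Connector

variable {𝕜 : Type*} [RCLike 𝕜]

/-- The connector `(1 - z)_m n! / (m + 1 + n)!`. -/
noncomputable def conn (z : 𝕜) (m n : ℕ) : 𝕜 :=
  (∏ j ∈ Finset.range m, ((j : 𝕜) + 1 - z)) * n.factorial / (m + 1 + n).factorial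

lemma conn_succ_right (z : 𝕜) (m n : ℕ) :
    conn z m (n + 1) = conn z m n * (n + 1) / (m + n + 2) := by
  have h1 : ((m + 1 + n).factorial : 𝕜) ≠ 0 := by exact_mod_cast Nat.factorial_ne_zero _
  have h2 : ((m : 𝕜) + n + 2) ≠ 0 := by exact_mod_cast (by omega : m + n + 2 ≠ 0)
  have e : (m + 1 + (n + 1)).factorial = (m + n + 2) * (m + 1 + n).factorial := by
    rw [show m + 1 + (n + 1) = (m + 1 + n) + 1 by ring, Nat.factorial_succ]; ring
  unfold conn
  rw [e, Nat.factorial_succ]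
  push_cast
  field_simp

lemma conn_succ_left (z : 𝕜) (m n : ℕ) :
    conn z (m + 1) n = conn z m n * (m + 1 - z) / (m + n + 2) := by
  have h1 : ((m + 1 + n).factorial : 𝕜) ≠ 0 := by exact_mod_cast Nat.factorial_ne_zero _
  have h2 : ((m : 𝕜) + n + 2) ≠ 0 := by exact_mod_cast (by omega : m + n + 2 ≠ 0)
  have e : (m + 1 + 1 + n).factorial = (m + n + 2) * (m + 1 + n).factorial := by
    rw [show m + 1 + 1 + n = (m + 1 + n) + 1 by ring, Nat.factorial_succ]; ring
  unfold conn
  rw [e, Finset.prod_range_succ]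
  push_cast
  field_simp

lemma conn_real_nonneg (m n : ℕ) : 0 ≤ conn (-1 / 4 : ℝ) m n := by
  unfold conn
  have : ∀ j : ℕ, (0 : ℝ) ≤ j + 1 - -1 / 4 := fun j => by
    linarith [(Nat.cast_nonneg j : (0 : ℝ) ≤ j)]
  have := Finset.prod_nonneg (fun j (_ : j ∈ Finset.range m) => this j)
  positivity

lemma norm_conn_le {z : 𝕜} (hz : ‖z‖ ≤ 1 / 4) (m n : ℕ) :
    ‖conn z m n‖ ≤ conn (-1 / 4 : ℝ) m n := by
  unfold conn
  rw [norm_div, norm_mul, norm_prod, RCLike.norm_natCast, RCLike.norm_natCast]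
  gcongr with j _
  calc ‖(j : 𝕜) + 1 - z‖ ≤ ‖((j + 1 : ℕ) : 𝕜)‖ + ‖z‖ := by push_cast; exact norm_sub_le _ _
    _ ≤ _ := by rw [RCLike.norm_natCast]; push_cast; linarith

lemma conn_real_le_right (m n : ℕ) :
    conn (-1 / 4 : ℝ) m n ≤ conn (-1 / 4 : ℝ) m 0 / (n + 1) := by
  have h0 := conn_real_nonneg m 0
  induction n with
  | zero => simp
  | succ n ih =>
    rw [conn_succ_right]
    push_cast
    calc conn (-1 / 4 : ℝ) m n * (n + 1) / (m + n + 2)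
        ≤ (conn (-1 / 4 : ℝ) m 0 / (n + 1)) * (n + 1) / (n + 2) := by
          gcongr
          linarith [(Nat.cast_nonneg m : (0 : ℝ) ≤ m)]
      _ = _ := by field_simp; ring

lemma conn_real_le_left (m n : ℕ) : conn (-1 / 4 : ℝ) m n ≤ 1 / √(m + 1) := by
  have h0 : conn (-1 / 4 : ℝ) m n ≤ conn (-1 / 4 : ℝ) m 0 :=
    (conn_real_le_right m n).trans (div_le_self (conn_real_nonneg _ _) (by linarith [(Nat.cast_nonneg n : (0 : ℝ) ≤ n)]))
  refine h0.trans ?_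
  have h1 : conn (-1 / 4 : ℝ) m 0 ^ 2 * (m + 1) ≤ 1 := by
    induction m with
    | zero => simp [conn]
    | succ m ih =>
      have ih := ih ((conn_real_le_right m n).trans (div_le_self (conn_real_nonneg _ _) (by linarith [(Nat.cast_nonneg n : (0 : ℝ) ≤ n)])))
      refine le_trans ?_ ih
      rw [conn_succ_left]
      push_cast
      have hc := sq_nonneg (conn (-1 / 4 : ℝ) m 0)
      set c := conn (-1 / 4 : ℝ) m 0
      have : (c * (m + 1 - -1 / 4) / (m + 0 + 2)) ^ 2 * (m + 1 + 1)
          = c ^ 2 * ((m + 5 / 4) ^ 2 / (m + 2)) := by field_simp; ring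
      rw [this]
      refine mul_le_mul_of_nonneg_left ?_ hc
      rw [div_le_iff₀ (by positivity)]
      nlinarith [(Nat.cast_nonneg m : (0 : ℝ) ≤ m)]
  rw [le_div_iff₀ (by positivity)]
  refine abs_le_of_sq_le_sq' ?_ zero_le_one |>.2
  rw [mul_pow, Real.sq_sqrt (by positivity)]
  simpa using h1

lemma tendsto_conn_right {z : 𝕜} (hz : ‖z‖ ≤ 1 / 4) (m n : ℕ) :
    Tendsto (fun j => conn z m (n + j)) atTop (𝓝 0) := by
  have h : Tendsto (fun j : ℕ => conn (-1 / 4 : ℝ) m 0 / ((j : ℝ) + 1)) atTop (𝓝 0) := by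
    simpa [div_eq_mul_inv] using
      (tendsto_one_div_add_atTop_nhds_zero_nat (𝕜 := ℝ)).const_mul (conn (-1 / 4 : ℝ) m 0)
  refine squeeze_zero_norm (fun j => ?_) h
  refine (norm_conn_le hz _ _).trans ((conn_real_le_right _ _).trans ?_)
  have := conn_real_nonneg m 0
  gcongr
  omega

lemma tendsto_conn_left {z : 𝕜} (hz : ‖z‖ ≤ 1 / 4) (m n : ℕ) :
    Tendsto (fun j => conn z (m + j) n) atTop (𝓝 0) := by
  have h : Tendsto (fun j : ℕ => 1 / √((j : ℝ) + 1)) atTop (𝓝 0) := by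
    simp only [one_div]
    refine tendsto_inv_atTop_zero.comp (Real.tendsto_sqrt_atTop.comp ?_)
    exact tendsto_atTop_add_const_right _ _ tendsto_natCast_atTop_atTop
  refine squeeze_zero_norm (fun j => ?_) h
  refine (norm_conn_le hz _ _).trans ((conn_real_le_left _ _).trans ?_)
  gcongr
  omega

lemma conn_sub_right (z : 𝕜) (m n : ℕ) :
    (conn z m n - conn z m (n + 1)) / (m + 1) = conn z m (n + 1) / (n + 1) := by
  rw [conn_succ_right]
  have h0 : ((m : 𝕜) + 1) ≠ 0 := by exact_mod_cast (by omega : m + 1 ≠ 0)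
  have h1 : ((n : 𝕜) + 1) ≠ 0 := by exact_mod_cast (by omega : n + 1 ≠ 0)
  have h2 : ((m : 𝕜) + n + 2) ≠ 0 := by exact_mod_cast (by omega : m + n + 2 ≠ 0)
  field_simp
  ring

lemma natCast_succ_add_ne_zero {z : 𝕜} (hz : ‖z‖ ≤ 1 / 4) (q : ℕ) : (q : 𝕜) + 1 + z ≠ 0 := by
  intro h
  have h1 : ((q + 1 : ℕ) : 𝕜) = -z := by push_cast; linear_combination h
  have h2 : ((q + 1 : ℕ) : ℝ) = ‖z‖ := by rw [← RCLike.norm_natCast (K := 𝕜), h1, norm_neg]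
  push_cast at h2
  linarith [(Nat.cast_nonneg q : (0 : ℝ) ≤ q)]

lemma conn_sub_left {z : 𝕜} (hz : ‖z‖ ≤ 1 / 4) (m q : ℕ) :
    (q + 1) / (q + 1 + z) * (conn z m q - conn z (m + 1) q) = conn z m (q + 1) := by
  rw [conn_succ_left, conn_succ_right]
  have h1 := natCast_succ_add_ne_zero hz q
  have h2 : ((m : 𝕜) + q + 2) ≠ 0 := by exact_mod_cast (by omega : m + q + 2 ≠ 0)
  field_simp
  ring

lemma hasSum_conn_right_real (m n : ℕ) :
    HasSum (fun j : ℕ => conn (-1 / 4 : ℝ) m (n + j + 1) / ((n + j : ℕ) + 1))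
      (conn (-1 / 4 : ℝ) m n / (m + 1)) := by
  rw [hasSum_iff_tendsto_nat_of_nonneg (fun j => div_nonneg (conn_real_nonneg _ _) (by positivity))]
  have h : ∀ N, ∑ j ∈ Finset.range N, conn (-1 / 4 : ℝ) m (n + j + 1) / ((n + j : ℕ) + 1)
      = (conn (-1 / 4 : ℝ) m n - conn (-1 / 4 : ℝ) m (n + N)) / (m + 1) := fun N => by
    simp_rw [← conn_sub_right, ← Finset.sum_div]
    congr 1
    exact Finset.sum_range_sub' (fun j => conn (-1 / 4 : ℝ) m (n + j)) N
  simp_rw [h]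
  have := ((tendsto_conn_right (𝕜 := ℝ) (z := -1 / 4) (by norm_num) m n).const_sub
    (conn (-1 / 4 : ℝ) m n)).div_const ((m : ℝ) + 1)
  simpa using this

lemma hasSum_conn_right {z : 𝕜} (hz : ‖z‖ ≤ 1 / 4) (m n : ℕ) :
    HasSum (fun j : ℕ => conn z m (n + j + 1) / ((n + j : ℕ) + 1)) (conn z m n / (m + 1)) := by
  have hs : Summable (fun j : ℕ => conn z m (n + j + 1) / ((n + j : ℕ) + 1)) := by
    refine Summable.of_norm_bounded (hasSum_conn_right_real m n).summable (fun j => ?_)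
    rw [norm_div]
    have : ‖(((n + j : ℕ) : 𝕜) + 1)‖ = ((n + j : ℕ) : ℝ) + 1 := by
      have := RCLike.norm_natCast (K := 𝕜) (n + j + 1)
      push_cast at this ⊢
      exact this
    rw [this]
    gcongr
    exact norm_conn_le hz _ _
  rw [hs.hasSum_iff_tendsto_nat]
  have h : ∀ N, ∑ j ∈ Finset.range N, conn z m (n + j + 1) / ((n + j : ℕ) + 1)
      = (conn z m n - conn z m (n + N)) / (m + 1) := fun N => by
    simp_rw [← conn_sub_right, ← Finset.sum_div]
    congr 1
    exact Finset.sum_range_sub' (fun j => conn z m (n + j)) N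
  simp_rw [h]
  have := ((tendsto_conn_right hz m n).const_sub (conn z m n)).div_const ((m : 𝕜) + 1)
  simpa using this

lemma sum_conn_left {z : 𝕜} (hz : ‖z‖ ≤ 1 / 4) (p q N : ℕ) :
    ∑ j ∈ Finset.range N, conn z (p + j) (q + 1)
      = (q + 1) / (q + 1 + z) * (conn z p q - conn z (p + N) q) := by
  simp_rw [← conn_sub_left hz, ← Finset.mul_sum]
  congr 1
  exact Finset.sum_range_sub' (fun j => conn z (p + j) q) N

lemma tendsto_sum_conn_left {z : 𝕜} (hz : ‖z‖ ≤ 1 / 4) (p q : ℕ) :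
    Tendsto (fun N => ∑ j ∈ Finset.range N, conn z (p + j) (q + 1)) atTop
      (𝓝 ((q + 1) / (q + 1 + z) * conn z p q)) := by
  simp_rw [sum_conn_left hz]
  have := ((tendsto_conn_left hz p q).const_sub (conn z p q)).const_mul (((q : 𝕜) + 1) / (q + 1 + z))
  simpa using this

lemma hasSum_conn_left_real (p q : ℕ) :
    HasSum (fun j => conn (-1 / 4 : ℝ) (p + j) (q + 1))
      ((q + 1) / (q + 1 + -1 / 4) * conn (-1 / 4 : ℝ) p q) := by
  rw [hasSum_iff_tendsto_nat_of_nonneg (fun j => conn_real_nonneg _ _)]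
  exact tendsto_sum_conn_left (by norm_num) p q

lemma hasSum_conn_left {z : 𝕜} (hz : ‖z‖ ≤ 1 / 4) (p q : ℕ) :
    HasSum (fun j => conn z (p + j) (q + 1)) ((q + 1) / (q + 1 + z) * conn z p q) := by
  have hs : Summable (fun j => conn z (p + j) (q + 1)) :=
    Summable.of_norm_bounded (hasSum_conn_left_real p q).summable (fun j => norm_conn_le hz _ _)
  rw [hs.hasSum_iff_tendsto_nat]
  exact tendsto_sum_conn_left hz p q

end Connector

section Rearrangement

lemma tsum_sum_antidiagonal_ennreal (f : ℕ × ℕ → ℝ≥0∞) :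
    ∑' m, ∑ x ∈ Finset.HasAntidiagonal.antidiagonal m, f x = ∑' x, f x := by
  rw [← Finset.HasAntidiagonal.sigmaAntidiagonalEquivProd.tsum_eq f, ENNReal.tsum_sigma']
  refine tsum_congr fun m => ?_
  rw [tsum_fintype]
  exact (Finset.sum_coe_sort (Finset.HasAntidiagonal.antidiagonal m) f).symm

lemma hasSum_sum_antidiagonal {f : ℕ × ℕ → ℂ} {a : ℂ} (h : HasSum f a) :
    HasSum (fun m => ∑ x ∈ Finset.HasAntidiagonal.antidiagonal m, f x) a := by
  refine (Finset.HasAntidiagonal.sigmaAntidiagonalEquivProd.hasSum_iff.mpr h).sigma fun m => ?_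
  convert hasSum_fintype _ using 1
  exact (Finset.sum_coe_sort (Finset.HasAntidiagonal.antidiagonal m) f).symm

lemma summable_of_tsum_tsum_enorm_le {f : ℕ × ℕ → ℂ} {g : ℕ → ℕ → ℝ≥0∞}
    (hfg : ∀ i j, ‖f (i, j)‖ₑ ≤ g i j) (hg : ∑' i, ∑' j, g i j ≠ ∞) : Summable f := by
  refine Summable.of_enorm (ne_top_of_le_ne_top hg ?_)
  rw [← ENNReal.tsum_prod]
  exact ENNReal.tsum_le_tsum fun x => hfg x.1 x.2

/-- Interchange of a double sum in which the inner sums over the second index are known. -/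
lemma hasSum_swap {f : ℕ × ℕ → ℂ} (hf : Summable f) {a : ℕ → ℂ}
    (ha : ∀ i, HasSum (fun j => f (i, j)) (a i)) :
    HasSum (fun j => ∑' i, f (i, j)) (∑' i, a i) := by
  have h1 : HasSum f (∑' i, a i) := by
    rw [← (hf.hasSum.prod_fiberwise ha).tsum_eq.symm]
    exact hf.hasSum
  refine HasSum.prod_fiberwise ((Equiv.prodComm ℕ ℕ).hasSum_iff.mpr h1) fun j => ?_
  exact (hf.prod_symm.prod_factor j).hasSum

lemma hasSum_of_hasSum_prod {f : ℕ × ℕ → ℂ} (hf : Summable f) {a : ℕ → ℂ}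
    (ha : ∀ i, HasSum (fun j => f (i, j)) (a i)) : HasSum f (∑' i, a i) := by
  rw [← (hf.hasSum.prod_fiberwise ha).tsum_eq.symm]
  exact hf.hasSum

lemma tsum_inv_mul_inv_le (n : ℕ) :
    ∑' j : ℕ, (((n + j : ℕ) : ℝ≥0∞) + 1)⁻¹ * (((n + j : ℕ) : ℝ≥0∞) + 1)⁻¹
      ≤ 2 * ((n : ℝ≥0∞) + 1)⁻¹ := by
  have key : HasSum (fun j : ℕ => 2 * (1 / ((n + j : ℕ) + 1 : ℝ) - 1 / ((n + (j + 1) : ℕ) + 1 : ℝ)))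
      (2 * (1 / ((n : ℝ) + 1))) := by
    refine HasSum.mul_left 2 ?_
    rw [hasSum_iff_tendsto_nat_of_nonneg]
    · have h : ∀ N, ∑ j ∈ Finset.range N,
          (1 / ((n + j : ℕ) + 1 : ℝ) - 1 / ((n + (j + 1) : ℕ) + 1 : ℝ))
          = 1 / ((n : ℝ) + 1) - 1 / ((N + n : ℕ) + 1 : ℝ) := fun N => by
        rw [Finset.sum_range_sub' (fun j : ℕ => 1 / ((n + j : ℕ) + 1 : ℝ))]
        simp [add_comm]
      simp_rw [h]
      have := ((tendsto_add_atTop_iff_nat n).mpr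
        (tendsto_one_div_add_atTop_nhds_zero_nat (𝕜 := ℝ))).const_sub (1 / ((n : ℝ) + 1))
      simpa using this
    · intro j
      rw [sub_nonneg]
      gcongr
      omega
  have hle : ∀ j : ℕ, 1 / ((n + j : ℕ) + 1 : ℝ) * (1 / ((n + j : ℕ) + 1 : ℝ))
      ≤ 2 * (1 / ((n + j : ℕ) + 1 : ℝ) - 1 / ((n + (j + 1) : ℕ) + 1 : ℝ)) := fun j => by
    push_cast
    rw [div_sub_div _ _ (by positivity) (by positivity), ← mul_div_assoc (2 : ℝ), div_mul_div_comm,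
      div_le_div_iff₀ (by positivity) (by positivity)]
    have : (0 : ℝ) ≤ n + j := by positivity
    nlinarith [mul_nonneg this (mul_nonneg this this), mul_nonneg this this]
  have hcast : ∀ a : ℕ, ((a : ℝ≥0∞) + 1)⁻¹ = ENNReal.ofReal (1 / ((a : ℝ) + 1)) := fun a => by
    rw [one_div, ENNReal.ofReal_inv_of_pos (by positivity), ENNReal.ofReal_add (by positivity)
      zero_le_one, ENNReal.ofReal_natCast, ENNReal.ofReal_one]
  have hr : (2 : ℝ≥0∞) * ((n : ℝ≥0∞) + 1)⁻¹ = ENNReal.ofReal (2 * (1 / ((n : ℝ) + 1))) := by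
    rw [ENNReal.ofReal_mul zero_le_two, hcast, ENNReal.ofReal_ofNat]
  rw [hr, ← key.tsum_eq, ENNReal.ofReal_tsum_of_nonneg (fun j => le_trans (by positivity) (hle j)) key.summable]
  refine ENNReal.tsum_le_tsum fun j => ?_
  rw [hcast, ← ENNReal.ofReal_mul (by positivity)]
  exact ENNReal.ofReal_le_ofReal (hle j)

end Rearrangement

section Transport

/-- The majorant of the connector for `‖z‖ ≤ 1 / 4`. -/
noncomputable def connMajorant (m n : ℕ) : ℝ≥0∞ := ENNReal.ofReal (conn (-1 / 4 : ℝ) m n)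

lemma enorm_conn_le {z : ℂ} (hz : ‖z‖ ≤ 1 / 4) (m n : ℕ) : ‖conn z m n‖ₑ ≤ connMajorant m n := by
  rw [← ofReal_norm]
  exact ENNReal.ofReal_le_ofReal (norm_conn_le hz m n)

lemma ofReal_natCast_add_one (n : ℕ) : ENNReal.ofReal ((n : ℝ) + 1) = (n : ℝ≥0∞) + 1 := by
  rw [ENNReal.ofReal_add (by positivity) zero_le_one, ENNReal.ofReal_natCast, ENNReal.ofReal_one]

lemma tsum_connMajorant_right (m n : ℕ) :
    ∑' j : ℕ, connMajorant m (n + j + 1) / ((n + j : ℕ) + 1) = connMajorant m n / (m + 1) := by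
  have h := hasSum_conn_right_real m n
  have h2 := congrArg ENNReal.ofReal h.tsum_eq
  rw [ENNReal.ofReal_tsum_of_nonneg (fun j => div_nonneg (conn_real_nonneg _ _) (by positivity))
    h.summable] at h2
  simp_rw [ENNReal.ofReal_div_of_pos (show (0 : ℝ) < (m : ℕ) + 1 by positivity),
    ENNReal.ofReal_div_of_pos (show (0 : ℝ) < ((n + _ : ℕ) : ℝ) + 1 by positivity),
    ofReal_natCast_add_one] at h2
  exact h2

lemma tsum_connMajorant_left_le (p q : ℕ) :
    ∑' j : ℕ, connMajorant (p + j) (q + 1) ≤ 2 * connMajorant p q := by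
  have h := hasSum_conn_left_real p q
  have h2 := congrArg ENNReal.ofReal h.tsum_eq
  rw [ENNReal.ofReal_tsum_of_nonneg (fun j => conn_real_nonneg _ _) h.summable] at h2
  unfold connMajorant
  rw [h2, ← ENNReal.ofReal_ofNat 2, ← ENNReal.ofReal_mul zero_le_two]
  refine ENNReal.ofReal_le_ofReal (mul_le_mul_of_nonneg_right ?_ (conn_real_nonneg _ _))
  have : (0 : ℝ) ≤ q := q.cast_nonneg
  rw [div_le_iff₀ (by linarith)]
  linarith

/-- Either the sequence `t` itself or its partial sums. -/
noncomputable def cum (b : Bool) (t : ℕ → NNReal) (m : ℕ) : NNReal :=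
  if b then ∑ p ∈ Finset.range (m + 1), t p else t m

/-- The star sum attached to a word; the argument `m` stands for the
largest summation variable `m + 1`. -/
noncomputable def wordStar : List Bool → ℕ → NNReal
  | [], m => if m = 0 then 1 else 0
  | b :: u, m => cum b (wordStar u) m / (m + 1)

/-- The connected sum of a word. -/
noncomputable def connSum (z : ℂ) (u : List Bool) (n : ℕ) : ℂ :=
  ∑' m, ((wordStar u m : ℝ) : ℂ) * conn z m n

lemma cum_true_mul (t : ℕ → NNReal) (m : ℕ) (c : ℝ≥0∞) :
    (cum true t m : ℝ≥0∞) * c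
      = ∑ x ∈ Finset.HasAntidiagonal.antidiagonal m, (t x.1 : ℝ≥0∞) * c := by
  rw [Finset.Nat.sum_antidiagonal_eq_sum_range_succ_mk]
  simp [cum, Finset.sum_mul]

lemma tsum_cum_le {t : ℕ → NNReal} {K : ℝ≥0∞}
    (h : ∀ n : ℕ, ∑' m, (t m : ℝ≥0∞) * connMajorant m n ≤ K * ((n : ℝ≥0∞) + 1)⁻¹)
    (b : Bool) (q : ℕ) :
    ∑' m, (cum b t m : ℝ≥0∞) * connMajorant m (q + 1) ≤ 2 * K * ((q : ℝ≥0∞) + 1)⁻¹ := by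
  cases b with
  | false =>
    simp only [cum]
    refine (h (q + 1)).trans ?_
    gcongr
    · exact le_mul_of_one_le_left zero_le (by norm_num)
    · simp
  | true =>
    have h1 : ∀ m, (cum true t m : ℝ≥0∞) * connMajorant m (q + 1)
        = ∑ x ∈ Finset.HasAntidiagonal.antidiagonal m, (t x.1 : ℝ≥0∞) * connMajorant (x.1 + x.2) (q + 1) := by
      intro m
      rw [cum_true_mul]
      refine Finset.sum_congr rfl fun x hx => ?_
      rw [Finset.HasAntidiagonal.mem_antidiagonal.mp hx]
    simp_rw [h1]
    rw [tsum_sum_antidiagonal_ennreal (fun x => (t x.1 : ℝ≥0∞) * connMajorant (x.1 + x.2) (q + 1)),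
      ENNReal.tsum_prod (f := fun a b => (t a : ℝ≥0∞) * connMajorant (a + b) (q + 1))]
    simp_rw [ENNReal.tsum_mul_left]
    calc ∑' p, (t p : ℝ≥0∞) * ∑' j, connMajorant (p + j) (q + 1)
        ≤ ∑' p, 2 * ((t p : ℝ≥0∞) * connMajorant p q) := by
          refine ENNReal.tsum_le_tsum fun p => ?_
          rw [mul_left_comm]
          gcongr
          exact tsum_connMajorant_left_le p q
      _ ≤ _ := by
          rw [ENNReal.tsum_mul_left, mul_assoc]
          gcongr
          exact h q

lemma coe_wordStar_cons (b : Bool) (u : List Bool) (m : ℕ) :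
    (wordStar (b :: u) m : ℝ≥0∞) = (cum b (wordStar u) m : ℝ≥0∞) / (m + 1) := by
  rw [wordStar, ENNReal.coe_div (by positivity)]
  simp

lemma tsum_wordStar_cons (b : Bool) (u : List Bool) (n : ℕ) :
    ∑' m, (wordStar (b :: u) m : ℝ≥0∞) * connMajorant m n
      = ∑' j : ℕ, ∑' m, (cum b (wordStar u) m : ℝ≥0∞) * connMajorant m (n + j + 1)
          / ((n + j : ℕ) + 1) := by
  rw [ENNReal.tsum_comm]
  refine tsum_congr fun m => ?_
  simp_rw [mul_div_assoc]
  rw [ENNReal.tsum_mul_left, tsum_connMajorant_right, coe_wordStar_cons]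
  simp only [div_eq_mul_inv]
  ring

lemma exists_tsum_wordStar_le (u : List Bool) :
    ∃ K : ℝ≥0∞, K ≠ ∞ ∧
      ∀ n : ℕ, ∑' m, (wordStar u m : ℝ≥0∞) * connMajorant m n ≤ K * ((n : ℝ≥0∞) + 1)⁻¹ := by
  induction u with
  | nil =>
    refine ⟨1, by simp, fun n => ?_⟩
    rw [tsum_eq_single 0 (fun m hm => by simp [wordStar, hm])]
    simp only [wordStar, if_true, ENNReal.coe_one, one_mul]
    rw [← ofReal_natCast_add_one, ← ENNReal.ofReal_inv_of_pos (by positivity)]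
    refine ENNReal.ofReal_le_ofReal ((conn_real_le_right 0 n).trans ?_)
    simp [conn]
  | cons b u ih =>
    obtain ⟨K, hK, h⟩ := ih
    refine ⟨2 * K * 2, by finiteness, fun n => ?_⟩
    rw [tsum_wordStar_cons]
    simp_rw [div_eq_mul_inv, ENNReal.tsum_mul_right]
    calc _ ≤ ∑' j : ℕ, 2 * K * ((((n + j : ℕ) : ℝ≥0∞) + 1)⁻¹ * (((n + j : ℕ) : ℝ≥0∞) + 1)⁻¹) := by
          refine ENNReal.tsum_le_tsum fun j => ?_
          rw [← mul_assoc]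
          gcongr
          exact tsum_cum_le h b (n + j)
      _ ≤ _ := by
          rw [ENNReal.tsum_mul_left, mul_assoc (2 * K)]
          gcongr
          exact tsum_inv_mul_inv_le n

lemma tsum_wordStar_ne_top (u : List Bool) (n : ℕ) :
    ∑' m, (wordStar u m : ℝ≥0∞) * connMajorant m n ≠ ∞ := by
  obtain ⟨K, hK, h⟩ := exists_tsum_wordStar_le u
  refine ne_top_of_le_ne_top ?_ (h n)
  exact ENNReal.mul_ne_top hK (by simp)

lemma enorm_coe_mul_conn_le {z : ℂ} (hz : ‖z‖ ≤ 1 / 4) (t : NNReal) (m n : ℕ) :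
    ‖((t : ℝ) : ℂ) * conn z m n‖ₑ ≤ (t : ℝ≥0∞) * connMajorant m n := by
  rw [enorm_mul]
  gcongr
  · simp [enorm_eq_nnnorm]
  · exact enorm_conn_le hz m n

lemma hasSum_connSum {z : ℂ} (hz : ‖z‖ ≤ 1 / 4) (u : List Bool) (n : ℕ) :
    HasSum (fun m => ((wordStar u m : ℝ) : ℂ) * conn z m n) (connSum z u n) := by
  refine (Summable.of_enorm (ne_top_of_le_ne_top (tsum_wordStar_ne_top u n) ?_)).hasSum
  exact ENNReal.tsum_le_tsum fun m => enorm_coe_mul_conn_le hz _ _ _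

lemma connSum_nil (z : ℂ) (n : ℕ) : connSum z [] n = 1 / (n + 1) := by
  unfold connSum
  rw [tsum_eq_single 0 (fun m hm => by simp [wordStar, hm])]
  have h : (n.factorial : ℂ) ≠ 0 := by exact_mod_cast n.factorial_ne_zero
  have h1 : (n : ℂ) + 1 ≠ 0 := by exact_mod_cast n.succ_ne_zero
  simp only [conn, wordStar, Finset.range_zero, Finset.prod_empty, zero_add, add_comm 1 n,
    Nat.factorial_succ]
  push_cast
  field_simp

/-- The value of a connected sum after moving the first letter of the word `b :: u`, as a
function of the new largest variable. -/
noncomputable def connTerm (z : ℂ) (b : Bool) (u : List Bool) (q : ℕ) : ℂ :=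
  if b then connSum z u q / (q + 1 + z) else connSum z u (q + 1) / (q + 1)

lemma hasSum_cum {z : ℂ} (hz : ‖z‖ ≤ 1 / 4) (b : Bool) (u : List Bool) (q : ℕ) :
    HasSum (fun m => ((cum b (wordStar u) m : ℝ) : ℂ) * conn z m (q + 1) / (q + 1))
      (connTerm z b u q) := by
  have hq : (q : ℂ) + 1 ≠ 0 := by exact_mod_cast q.succ_ne_zero
  cases b with
  | false =>
    simp only [cum, connTerm]
    exact (hasSum_connSum hz u (q + 1)).div_const _
  | true =>
    let f : ℕ × ℕ → ℂ := fun x => ((wordStar u x.1 : ℝ) : ℂ) * conn z (x.1 + x.2) (q + 1)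
    have hf : Summable f := by
      refine summable_of_tsum_tsum_enorm_le
        (g := fun p j => (wordStar u p : ℝ≥0∞) * connMajorant (p + j) (q + 1))
        (fun p j => enorm_coe_mul_conn_le hz _ _ _) ?_
      simp_rw [ENNReal.tsum_mul_left]
      refine ne_top_of_le_ne_top (b := 2 * ∑' p, (wordStar u p : ℝ≥0∞) * connMajorant p q)
        (ENNReal.mul_ne_top (by simp) (tsum_wordStar_ne_top u q)) ?_
      rw [← ENNReal.tsum_mul_left]
      refine ENNReal.tsum_le_tsum fun p => ?_
      rw [mul_left_comm]
      gcongr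
      exact tsum_connMajorant_left_le p q
    have h1 := hasSum_of_hasSum_prod hf
      (a := fun p => ((wordStar u p : ℝ) : ℂ) * ((q + 1) / (q + 1 + z) * conn z p q))
      (fun p => (hasSum_conn_left hz p q).mul_left _)
    have h2 := (hasSum_sum_antidiagonal h1).div_const ((q : ℂ) + 1)
    have h3 : (∑' p, ((wordStar u p : ℝ) : ℂ) * ((q + 1) / (q + 1 + z) * conn z p q)) / (q + 1)
        = connTerm z true u q := by
      have := ((hasSum_connSum hz u q).mul_left (((q : ℂ) + 1) / (q + 1 + z))).tsum_eq
      simp_rw [mul_left_comm _ (((q : ℂ) + 1) / (q + 1 + z))]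
      rw [this]
      simp only [connTerm, if_true]
      field_simp
    rw [h3] at h2
    refine h2.congr_fun ?_
    intro m
    congr 1
    rw [Finset.Nat.sum_antidiagonal_eq_sum_range_succ_mk]
    simp only [cum, if_true]
    push_cast
    rw [Finset.sum_mul]
    refine Finset.sum_congr rfl fun p hp => ?_
    have : p + (m - p) = m := by have := Finset.mem_range.mp hp; omega
    simp only [f, this]

lemma connSum_cons {z : ℂ} (hz : ‖z‖ ≤ 1 / 4) (b : Bool) (u : List Bool) (n : ℕ) :
    connSum z (b :: u) n = ∑' j, connTerm z b u (n + j) := by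
  let f : ℕ × ℕ → ℂ := fun x =>
    ((cum b (wordStar u) x.2 : ℝ) : ℂ) * conn z x.2 (n + x.1 + 1) / ((n + x.1 : ℕ) + 1)
  have hf : Summable f := by
    refine summable_of_tsum_tsum_enorm_le (g := fun j m => (cum b (wordStar u) m : ℝ≥0∞)
      * connMajorant m (n + j + 1) / ((n + j : ℕ) + 1)) (fun j m => ?_) ?_
    · simp only [f]
      rw [div_eq_mul_inv, div_eq_mul_inv, enorm_mul]
      gcongr
      · exact enorm_coe_mul_conn_le hz _ _ _
      · rw [enorm_inv (by exact_mod_cast (n + j).succ_ne_zero)]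
        have : ((((n + j : ℕ) : ℂ)) + 1) = ((n + j + 1 : ℕ) : ℂ) := by push_cast; ring
        rw [this, ← ofReal_norm, RCLike.norm_natCast, ENNReal.ofReal_natCast]
        push_cast
        rfl
    · rw [← tsum_wordStar_cons]
      exact tsum_wordStar_ne_top _ _
  have h := hasSum_swap hf (fun j => hasSum_cum hz b u (n + j))
  rw [← h.tsum_eq]
  refine tsum_congr fun m => ?_
  have h2 := ((hasSum_conn_right hz m n).mul_left ((cum b (wordStar u) m : ℝ) : ℂ)).tsum_eq
  simp only [f, mul_div_assoc]
  rw [h2, wordStar]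
  push_cast
  ring

end Transport

section Taylor

/-- The summand of `taylorCoeff` contributed by a letter. -/
noncomputable def taylorTerm (b : Bool) (c : ℕ → ℕ → ℝ≥0∞) (m q : ℕ) : ℝ≥0∞ :=
  if b then ∑ x ∈ Finset.HasAntidiagonal.antidiagonal m, ((q : ℝ≥0∞) + 1)⁻¹ ^ (x.1 + 1) * c x.2 q
  else ((q : ℝ≥0∞) + 1)⁻¹ * c m (q + 1)

/-- The absolute values of the Taylor coefficients of `connSum`. -/
noncomputable def taylorCoeff : List Bool → ℕ → ℕ → ℝ≥0∞
  | [], m, n => if m = 0 then ((n : ℝ≥0∞) + 1)⁻¹ else 0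
  | b :: u, m, n => ∑' j, taylorTerm b (taylorCoeff u) m (n + j)

lemma tsum_taylorTerm_le {c : ℕ → ℕ → ℝ≥0∞} {K : ℝ≥0∞}
    (h : ∀ n : ℕ, ∑' m, 4⁻¹ ^ m * c m n ≤ K * ((n : ℝ≥0∞) + 1)⁻¹) (b : Bool) (q : ℕ) :
    ∑' m, 4⁻¹ ^ m * taylorTerm b c m q
      ≤ 2 * K * (((q : ℝ≥0∞) + 1)⁻¹ * ((q : ℝ≥0∞) + 1)⁻¹) := by
  cases b with
  | false =>
    simp only [taylorTerm, Bool.false_eq_true, if_false]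
    simp_rw [mul_left_comm _ ((q : ℝ≥0∞) + 1)⁻¹]
    rw [ENNReal.tsum_mul_left]
    have h1 : ∑' m, 4⁻¹ ^ m * c m (q + 1) ≤ 2 * K * ((q : ℝ≥0∞) + 1)⁻¹ := by
      refine (h (q + 1)).trans ?_
      gcongr
      · exact le_mul_of_one_le_left zero_le (by norm_num)
      · simp
    calc _ ≤ ((q : ℝ≥0∞) + 1)⁻¹ * (2 * K * ((q : ℝ≥0∞) + 1)⁻¹) := by gcongr
      _ = _ := by ring
  | true =>
    have h1 : ∀ m, 4⁻¹ ^ m * taylorTerm true c m q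
        = ∑ x ∈ Finset.HasAntidiagonal.antidiagonal m,
          (4⁻¹ ^ x.1 * ((q : ℝ≥0∞) + 1)⁻¹ ^ (x.1 + 1)) * (4⁻¹ ^ x.2 * c x.2 q) := by
      intro m
      simp only [taylorTerm, if_true, Finset.mul_sum]
      refine Finset.sum_congr rfl fun x hx => ?_
      rw [← Finset.HasAntidiagonal.mem_antidiagonal.mp hx, pow_add]
      ring
    simp_rw [h1]
    rw [tsum_sum_antidiagonal_ennreal (fun x => (4⁻¹ ^ x.1 * ((q : ℝ≥0∞) + 1)⁻¹ ^ (x.1 + 1))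
        * (4⁻¹ ^ x.2 * c x.2 q)),
      ENNReal.tsum_prod (f := fun a b => (4⁻¹ ^ a * ((q : ℝ≥0∞) + 1)⁻¹ ^ (a + 1))
        * (4⁻¹ ^ b * c b q))]
    simp_rw [ENNReal.tsum_mul_left, ENNReal.tsum_mul_right]
    have h2 : ∑' l : ℕ, (4⁻¹ : ℝ≥0∞) ^ l * ((q : ℝ≥0∞) + 1)⁻¹ ^ (l + 1)
        ≤ 2 * ((q : ℝ≥0∞) + 1)⁻¹ := by
      calc ∑' l : ℕ, (4⁻¹ : ℝ≥0∞) ^ l * ((q : ℝ≥0∞) + 1)⁻¹ ^ (l + 1)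
          ≤ ∑' l : ℕ, (2⁻¹ : ℝ≥0∞) ^ l * ((q : ℝ≥0∞) + 1)⁻¹ := by
            refine ENNReal.tsum_le_tsum fun l => ?_
            gcongr
            · norm_num
            · refine pow_le_of_le_one zero_le ?_ (by omega)
              simp
        _ = _ := by
            rw [ENNReal.tsum_mul_right, ENNReal.tsum_geometric, ENNReal.one_sub_inv_two, inv_inv]
    calc _ ≤ (2 * ((q : ℝ≥0∞) + 1)⁻¹) * (K * ((q : ℝ≥0∞) + 1)⁻¹) := by gcongr; exact h q
      _ = _ := by ring

lemma tsum_taylorCoeff_cons (b : Bool) (u : List Bool) (n : ℕ) :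
    ∑' m, 4⁻¹ ^ m * taylorCoeff (b :: u) m n
      = ∑' j, ∑' m, 4⁻¹ ^ m * taylorTerm b (taylorCoeff u) m (n + j) := by
  rw [ENNReal.tsum_comm]
  simp_rw [ENNReal.tsum_mul_left, taylorCoeff]

lemma exists_tsum_taylorCoeff_le (u : List Bool) :
    ∃ K : ℝ≥0∞, K ≠ ∞ ∧
      ∀ n : ℕ, ∑' m, 4⁻¹ ^ m * taylorCoeff u m n ≤ K * ((n : ℝ≥0∞) + 1)⁻¹ := by
  induction u with
  | nil =>
    refine ⟨1, by simp, fun n => ?_⟩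
    rw [tsum_eq_single 0 (fun m hm => by simp [taylorCoeff, hm])]
    simp [taylorCoeff]
  | cons b u ih =>
    obtain ⟨K, hK, h⟩ := ih
    refine ⟨2 * K * 2, by finiteness, fun n => ?_⟩
    rw [tsum_taylorCoeff_cons]
    refine (ENNReal.tsum_le_tsum fun j => tsum_taylorTerm_le h b (n + j)).trans ?_
    rw [ENNReal.tsum_mul_left, mul_assoc (2 * K)]
    gcongr
    exact tsum_inv_mul_inv_le n

lemma tsum_taylorCoeff_ne_top (u : List Bool) (n : ℕ) :
    ∑' m, 4⁻¹ ^ m * taylorCoeff u m n ≠ ∞ := by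
  obtain ⟨K, hK, h⟩ := exists_tsum_taylorCoeff_le u
  exact ne_top_of_le_ne_top (ENNReal.mul_ne_top hK (by simp)) (h n)

lemma taylorCoeff_ne_top (u : List Bool) (m n : ℕ) : taylorCoeff u m n ≠ ∞ := by
  intro h
  refine ENNReal.ne_top_of_tsum_ne_top (tsum_taylorCoeff_ne_top u n) m ?_
  rw [h]
  exact ENNReal.mul_top (pow_ne_zero _ (by simp))

lemma taylorTerm_ne_top (b : Bool) (u : List Bool) (m q : ℕ) :
    taylorTerm b (taylorCoeff u) m q ≠ ∞ := by
  have h := taylorCoeff_ne_top (b :: u) m q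
  rw [taylorCoeff] at h
  simpa using ENNReal.ne_top_of_tsum_ne_top h 0

lemma enorm_pow_mul_toReal_le {z : ℂ} (hz : ‖z‖ ≤ 1 / 4) (m : ℕ) {a : ℝ≥0∞} (ha : a ≠ ∞) :
    ‖(-z) ^ m * ((a.toReal : ℝ) : ℂ)‖ₑ ≤ 4⁻¹ ^ m * a := by
  rw [enorm_mul, enorm_pow]
  gcongr
  · rw [← ofReal_norm, norm_neg]
    refine (ENNReal.ofReal_le_ofReal hz).trans (le_of_eq ?_)
    rw [one_div, ENNReal.ofReal_inv_of_pos (by norm_num), ENNReal.ofReal_ofNat]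
  · rw [← ofReal_norm, Complex.norm_real, Real.norm_of_nonneg ENNReal.toReal_nonneg,
      ENNReal.ofReal_toReal ha]

lemma toReal_natCast_add_one_inv (q : ℕ) :
    (((((q : ℝ≥0∞) + 1)⁻¹).toReal : ℝ) : ℂ) = ((q : ℂ) + 1)⁻¹ := by
  rw [ENNReal.toReal_inv, ENNReal.toReal_add (by simp) (by simp)]
  simp

lemma hasSum_inv_add {z : ℂ} (hz : ‖z‖ ≤ 1 / 4) (q : ℕ) :
    HasSum (fun l : ℕ => (-z) ^ l * ((q : ℂ) + 1)⁻¹ ^ (l + 1)) (((q : ℂ) + 1 + z)⁻¹) := by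
  have h1 : (q : ℂ) + 1 ≠ 0 := by exact_mod_cast q.succ_ne_zero
  have h2 := natCast_succ_add_ne_zero hz q
  have hn : ‖-z * ((q : ℂ) + 1)⁻¹‖ < 1 := by
    have : ‖(q : ℂ) + 1‖ = (q : ℝ) + 1 := by exact_mod_cast RCLike.norm_natCast (K := ℂ) (q + 1)
    rw [norm_mul, norm_neg, norm_inv, this, ← div_eq_mul_inv, div_lt_one (by positivity)]
    linarith [(Nat.cast_nonneg q : (0 : ℝ) ≤ q)]
  have h := (hasSum_geometric_of_norm_lt_one hn).mul_left (((q : ℂ) + 1)⁻¹)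
  have e : ((q : ℂ) + 1)⁻¹ * (1 - -z * ((q : ℂ) + 1)⁻¹)⁻¹ = ((q : ℂ) + 1 + z)⁻¹ := by
    rw [← mul_inv]
    congr 1
    field_simp
    ring
  rw [e] at h
  refine h.congr_fun fun l => ?_
  rw [mul_pow, pow_succ]
  ring

lemma hasSum_taylorTerm {z : ℂ} (hz : ‖z‖ ≤ 1 / 4) {u : List Bool}
    (ih : ∀ n, HasSum (fun m => (-z) ^ m * (((taylorCoeff u m n).toReal : ℝ) : ℂ)) (connSum z u n))
    (b : Bool) (q : ℕ) :
    HasSum (fun m => (-z) ^ m * (((taylorTerm b (taylorCoeff u) m q).toReal : ℝ) : ℂ))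
      (connTerm z b u q) := by
  cases b with
  | false =>
    simp only [connTerm, taylorTerm, Bool.false_eq_true, if_false]
    refine ((ih (q + 1)).div_const ((q : ℂ) + 1)).congr_fun fun m => ?_
    rw [ENNReal.toReal_mul, Complex.ofReal_mul, toReal_natCast_add_one_inv]
    ring
  | true =>
    have hg := hasSum_inv_add hz q
    have hsum := summable_mul_of_summable_norm (R := ℂ) hg.summable.norm (ih q).summable.norm
    have h := hasSum_sum_antidiagonal (hg.mul (ih q) hsum)
    have e : ((q : ℂ) + 1 + z)⁻¹ * connSum z u q = connTerm z true u q := by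
      simp only [connTerm, if_true]
      ring
    rw [e] at h
    refine h.congr_fun fun m => ?_
    simp only [taylorTerm, if_true]
    rw [ENNReal.toReal_sum (fun x _ => ENNReal.mul_ne_top (by simp) (taylorCoeff_ne_top _ _ _)),
      Complex.ofReal_sum, Finset.mul_sum]
    refine Finset.sum_congr rfl fun x hx => ?_
    rw [ENNReal.toReal_mul, ENNReal.toReal_pow, Complex.ofReal_mul, Complex.ofReal_pow,
      toReal_natCast_add_one_inv, ← Finset.HasAntidiagonal.mem_antidiagonal.mp hx, pow_add (-z)]
    ring

lemma hasSum_taylorCoeff {z : ℂ} (hz : ‖z‖ ≤ 1 / 4) (u : List Bool) (n : ℕ) :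
    HasSum (fun m => (-z) ^ m * (((taylorCoeff u m n).toReal : ℝ) : ℂ)) (connSum z u n) := by
  induction u generalizing n with
  | nil =>
    rw [connSum_nil]
    convert hasSum_single 0 (fun m hm => ?_) using 1
    · simp only [taylorCoeff, if_true, toReal_natCast_add_one_inv]
      simp
    · simp [taylorCoeff, hm]
  | cons b u ih =>
    rw [connSum_cons hz]
    let f : ℕ × ℕ → ℂ := fun x =>
      (-z) ^ x.2 * (((taylorTerm b (taylorCoeff u) x.2 (n + x.1)).toReal : ℝ) : ℂ)
    have hf : Summable f := by
      refine summable_of_tsum_tsum_enorm_le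
        (g := fun j m => 4⁻¹ ^ m * taylorTerm b (taylorCoeff u) m (n + j))
        (fun j m => enorm_pow_mul_toReal_le hz m (taylorTerm_ne_top _ _ _ _)) ?_
      rw [← tsum_taylorCoeff_cons]
      exact tsum_taylorCoeff_ne_top _ _
    refine (hasSum_swap hf (fun j => hasSum_taylorTerm hz ih b (n + j))).congr_fun fun m => ?_
    simp only [f]
    rw [tsum_mul_left, taylorCoeff, ENNReal.tsum_toReal_eq (fun j => taylorTerm_ne_top _ _ _ _),
      Complex.ofReal_tsum]

end Taylor

section StarSum

/-- The word of an index: each entry `a` becomes `a - 1` letters `false` and one `true`. -/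
def word : List ℕ → List Bool
  | [] => []
  | a :: ρ => List.replicate (a - 1) false ++ true :: word ρ

lemma wordStar_replicate_append (a : ℕ) (u : List Bool) (m : ℕ) :
    wordStar (List.replicate a false ++ u) m = wordStar u m / (m + 1) ^ a := by
  induction a with
  | zero => simp
  | succ a ih =>
    rw [List.replicate_succ, List.cons_append, wordStar]
    simp only [cum, Bool.false_eq_true, if_false, ih]
    rw [pow_succ, div_div]

lemma wordStar_word_cons {a : ℕ} (ha : 0 < a) (ρ : List ℕ) (m : ℕ) :
    wordStar (word (a :: ρ)) m
      = (∑ p ∈ Finset.range (m + 1), wordStar (word ρ) p) / (m + 1) ^ a := by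
  obtain ⟨a, rfl⟩ : ∃ c, a = c + 1 := ⟨a - 1, by omega⟩
  rw [word, wordStar_replicate_append, wordStar]
  simp only [cum, if_true, Nat.add_sub_cancel]
  rw [pow_succ', div_div]

open Classical in
/-- Sum over weakly increasing tuples of positive integers at most `M` whose last entry
satisfies `P`. -/
noncomputable def starFn (M r : ℕ) (e : ℕ → ℕ) (P : ℕ → Prop) : ℝ :=
  ∑ m : Fin r → Fin (M + 1),
    if (∀ i, 0 < (m i : ℕ)) ∧ (∀ i j : Fin r, i ≤ j → (m i : ℕ) ≤ (m j : ℕ)) ∧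
       (∀ i : Fin r, (i : ℕ) + 1 = r → P (m i))
    then ∏ i : Fin r, 1 / ((m i : ℕ) : ℝ) ^ e i else 0

lemma sStar_eq_starFn (k : List ℕ) (N : ℕ) :
    sStar k N = starFn N k.length (fun i => k.getD i 0) (· = N) := by
  unfold sStar starFn
  refine Finset.sum_congr rfl fun m _ => ?_
  simp only [List.get_eq_getElem, Fin.is_lt, List.getD_eq_getElem]

lemma starFn_congr (M r : ℕ) {e e' : ℕ → ℕ} (P : ℕ → Prop) (h : ∀ i < r, e i = e' i) :
    starFn M r e P = starFn M r e' P := by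
  unfold starFn
  refine Finset.sum_congr rfl fun m _ => ?_
  congr 1
  exact Finset.prod_congr rfl fun i _ => by rw [h i i.2]

lemma starFn_zero (M : ℕ) (e : ℕ → ℕ) (P : ℕ → Prop) : starFn M 0 e P = 1 := by
  simp [starFn]

lemma snoc_cond_iff {M r : ℕ} (P : ℕ → Prop) (x : Fin (M + 1)) (m : Fin r → Fin (M + 1)) :
    ((∀ i, 0 < ((Fin.snoc m x : Fin (r + 1) → Fin (M + 1)) i : ℕ)) ∧
      (∀ i j : Fin (r + 1), i ≤ j → ((Fin.snoc m x : Fin (r + 1) → Fin (M + 1)) i : ℕ)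
        ≤ ((Fin.snoc m x : Fin (r + 1) → Fin (M + 1)) j : ℕ)) ∧
      (∀ i : Fin (r + 1), (i : ℕ) + 1 = r + 1 →
        P ((Fin.snoc m x : Fin (r + 1) → Fin (M + 1)) i))) ↔
    (0 < (x : ℕ) ∧ P x) ∧ (∀ i, 0 < (m i : ℕ)) ∧
      (∀ i j : Fin r, i ≤ j → (m i : ℕ) ≤ (m j : ℕ)) ∧
      (∀ i : Fin r, (i : ℕ) + 1 = r → (m i : ℕ) ≤ x) := by
  simp only [Fin.forall_fin_succ', Fin.snoc_castSucc, Fin.snoc_last, Fin.castSucc_le_castSucc_iff,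
    Fin.val_castSucc, Fin.val_last, Fin.le_last, le_refl, forall_true_left]
  constructor
  · rintro ⟨⟨h1, h2⟩, ⟨h3, h4⟩, h5, h6⟩
    exact ⟨⟨h2, h6⟩, h1, fun i j hij => (h3 i).1 j hij, fun i _ => (h3 i).2⟩
  · rintro ⟨⟨h1, h2⟩, h3, h4, h5⟩
    refine ⟨⟨h3, h1⟩, ⟨fun i => ⟨fun j hij => h4 i j hij, ?_⟩, fun i hi => ?_, trivial⟩,
      fun i hi => ?_, h2⟩
    · have hr : 0 < r := i.pos
      refine (h4 i ⟨r - 1, by omega⟩ ?_).trans (h5 ⟨r - 1, by omega⟩ ?_)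
      · rw [Fin.le_def]
        simp only
        omega
      · simp only
        omega
    · exact absurd hi (by simp [Fin.le_def])
    · exact absurd hi (by have := i.2; omega)

open Classical in
lemma starFn_succ (M r : ℕ) (e : ℕ → ℕ) (P : ℕ → Prop) :
    starFn M (r + 1) e P = ∑ x ∈ Finset.range (M + 1),
      if 0 < x ∧ P x then 1 / (x : ℝ) ^ e r * starFn M r e (· ≤ x) else 0 := by
  rw [← Fin.sum_univ_eq_sum_range
    (fun x => if 0 < x ∧ P x then 1 / (x : ℝ) ^ e r * starFn M r e (· ≤ x) else 0)]
  unfold starFn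
  rw [← (Fin.snocEquiv (fun _ : Fin (r + 1) => Fin (M + 1))).sum_comp, Fintype.sum_prod_type]
  refine Finset.sum_congr rfl fun x _ => ?_
  simp only [Fin.snocEquiv, Equiv.coe_fn_mk, snoc_cond_iff, Fin.prod_univ_castSucc,
    Fin.snoc_castSucc, Fin.snoc_last, Fin.val_castSucc, Fin.val_last]
  by_cases h : 0 < (x : ℕ) ∧ P x
  · simp only [h, true_and, if_true, Finset.mul_sum, mul_ite, mul_zero, and_self]
    refine Finset.sum_congr rfl fun m _ => ?_
    rw [mul_comm]
  · simp only [h, false_and, if_false, Finset.sum_const_zero]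

lemma sum_range_ite_le (M N : ℕ) (hN : N ≤ M) (g : ℕ → ℝ) :
    ∑ x ∈ Finset.range (M + 1), (if 0 < x ∧ x ≤ N then g x else 0)
      = ∑ p ∈ Finset.range N, g (p + 1) := by
  rw [Finset.sum_range_succ']
  simp only [lt_irrefl, false_and, if_false, add_zero]
  rw [← Finset.sum_filter]
  refine Finset.sum_congr ?_ fun _ _ => rfl
  ext p
  simp only [Finset.mem_filter, Finset.mem_range]
  omega

lemma starFn_reverse_cons (M : ℕ) (a : ℕ) (ρ : List ℕ) (P : ℕ → Prop) [DecidablePred P] :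
    starFn M (a :: ρ).length (fun i => (a :: ρ).reverse.getD i 0) P
      = ∑ x ∈ Finset.range (M + 1), if 0 < x ∧ P x then
          1 / (x : ℝ) ^ a * starFn M ρ.length (fun i => ρ.reverse.getD i 0) (· ≤ x) else 0 := by
  rw [List.length_cons, starFn_succ]
  refine Finset.sum_congr rfl fun x _ => ?_
  have h1 : (a :: ρ).reverse.getD ρ.length 0 = a := by
    rw [List.reverse_cons, List.getD_append_right _ _ _ _ (by simp)]
    simp
  have h2 : ∀ i < ρ.length, (a :: ρ).reverse.getD i 0 = ρ.reverse.getD i 0 := fun i hi => by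
    rw [List.reverse_cons, List.getD_append _ _ _ _ (by simpa using hi)]
  rw [h1, starFn_congr M ρ.length _ h2]
  congr

lemma starFn_eq_sum_wordStar (M : ℕ) (ρ : List ℕ) (hρ : ∀ x ∈ ρ, 0 < x) (N : ℕ) (hN : N + 1 ≤ M) :
    starFn M ρ.length (fun i => ρ.reverse.getD i 0) (· ≤ N + 1)
      = ((∑ p ∈ Finset.range (N + 1), wordStar (word ρ) p : NNReal) : ℝ) := by
  induction ρ generalizing N with
  | nil =>
    rw [List.length_nil, starFn_zero]
    simp [word, wordStar]
  | cons a ρ ih =>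
    rw [starFn_reverse_cons, sum_range_ite_le _ _ hN]
    push_cast
    refine Finset.sum_congr rfl fun p hp => ?_
    have hp := Finset.mem_range.mp hp
    have := ih (fun x hx => hρ x (List.mem_cons_of_mem _ hx)) p (by omega)
    push_cast at this
    rw [this, wordStar_word_cons (hρ a List.mem_cons_self)]
    push_cast
    ring

lemma sStar_reverse (ρ : List ℕ) (hne : ρ ≠ []) (hρ : ∀ x ∈ ρ, 0 < x) (N : ℕ) :
    sStar ρ.reverse (N + 1) = wordStar (word ρ) N := by
  obtain ⟨a, ρ, rfl⟩ := List.exists_cons_of_ne_nil hne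
  rw [sStar_eq_starFn, List.length_reverse, starFn_reverse_cons,
    Finset.sum_eq_single (N + 1) (fun x _ hx => by simp [hx]) (fun h => by simp at h),
    starFn_eq_sum_wordStar _ _ (fun x hx => hρ x (List.mem_cons_of_mem _ hx)) N le_rfl,
    wordStar_word_cons (hρ a List.mem_cons_self)]
  simp only [Nat.succ_pos', and_self, if_true]
  push_cast
  ring

end StarSum

section NestedSum

/-- Nested sums indexed by a list of pairs: a letter deciding whether the next inequality is weak,
and an exponent. -/
noncomputable def listZeta : List (Bool × ℕ) → ℕ → ℝ≥0∞
  | [], _ => 1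
  | x :: L, p => ∑' j : ℕ,
      ((((p + j : ℕ) : ℝ≥0∞) + 1) ^ x.2)⁻¹ * listZeta L (if x.1 then p + j else p + j + 1)

/-- The pairs attached to an index and a tuple of extra exponents. -/
def blocks : (ρ : List ℕ) → (Fin ρ.length → ℕ) → List (Bool × ℕ)
  | [], _ => []
  | a :: ρ, l => List.replicate (a - 1) (false, 1) ++
      (true, l ⟨0, Nat.succ_pos _⟩ + 1) :: blocks ρ (fun i => l i.succ)

/-- The indicator of the tuples with sum `M` and positive last entry. -/
def tupleWeight {r : ℕ} (M : ℕ) (l : Fin r → ℕ) : ℝ≥0∞ :=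
  if (∑ i, l i) = M ∧ ∀ i : Fin r, (i : ℕ) + 1 = r → 1 ≤ l i then 1 else 0

lemma tupleWeight_one (m : ℕ) (l : Fin 1 → ℕ) :
    tupleWeight (m + 1) l = if l 0 = m + 1 then 1 else 0 := by
  unfold tupleWeight
  simp only [Finset.univ_unique, Fin.default_eq_zero, Finset.sum_singleton, Fin.forall_fin_one]
  congr 1
  simp only [eq_iff_iff]
  constructor
  · exact fun h => h.1
  · exact fun h => ⟨h, fun _ => by omega⟩

lemma tupleWeight_zero {r : ℕ} (l : Fin (r + 1) → ℕ) : tupleWeight 0 l = 0 := by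
  unfold tupleWeight
  rw [if_neg]
  rintro ⟨h, h'⟩
  have := h' (Fin.last r) (by simp)
  have := Finset.single_le_sum (f := l) (fun i _ => Nat.zero_le _) (Finset.mem_univ (Fin.last r))
  omega

lemma tupleWeight_cons {r : ℕ} (M c : ℕ) (l : Fin (r + 1) → ℕ) :
    tupleWeight M (Fin.cons c l : Fin (r + 1 + 1) → ℕ)
      = if c ≤ M then tupleWeight (M - c) l else 0 := by
  unfold tupleWeight
  rw [← ite_and]
  congr 1
  rw [Fin.sum_univ_succ, Fin.forall_fin_succ]
  simp only [Fin.cons_zero, Fin.cons_succ, Fin.val_zero, Fin.val_succ, eq_iff_iff]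
  constructor
  · rintro ⟨h1, -, h2⟩
    exact ⟨by omega, by omega, fun i hi => h2 i (by omega)⟩
  · rintro ⟨h1, h2, h3⟩
    exact ⟨by omega, by omega, fun i hi => h3 i (by omega)⟩

lemma tsum_fin_succ {r : ℕ} (f : (Fin (r + 1) → ℕ) → ℝ≥0∞) :
    ∑' n, f n = ∑' (c : ℕ) (n : Fin r → ℕ), f (Fin.cons c n) := by
  rw [← (Fin.consEquiv (fun _ : Fin (r + 1) => ℕ)).tsum_eq]
  exact ENNReal.tsum_prod (f := fun (c : ℕ) (n : Fin r → ℕ) => f (Fin.cons c n))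

lemma tsum_mul_listZeta_cons {ι : Type*} (f : ι → ℝ≥0∞) (b : Bool) (e : ι → ℕ)
    (L : ι → List (Bool × ℕ)) (n : ℕ) :
    ∑' i, f i * listZeta ((b, e i) :: L i) n = ∑' j : ℕ, ∑' i,
      f i * (((((n + j : ℕ) : ℝ≥0∞) + 1) ^ e i)⁻¹
        * listZeta (L i) (if b then n + j else n + j + 1)) := by
  rw [ENNReal.tsum_comm]
  simp_rw [listZeta, ENNReal.tsum_mul_left]

lemma taylorCoeff_replicate_append {ι : Type*} {f : ι → ℝ≥0∞} {L : ι → List (Bool × ℕ)}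
    {u : List Bool} {m : ℕ} (h : ∀ n, taylorCoeff u m n = ∑' i, f i * listZeta (L i) n)
    (a n : ℕ) :
    taylorCoeff (List.replicate a false ++ u) m n
      = ∑' i, f i * listZeta (List.replicate a (false, 1) ++ L i) n := by
  induction a generalizing n with
  | zero => simpa using h n
  | succ a ih =>
    simp only [List.replicate_succ, List.cons_append]
    rw [tsum_mul_listZeta_cons f false (fun _ => 1), taylorCoeff]
    refine tsum_congr fun j => ?_
    simp only [taylorTerm, Bool.false_eq_true, if_false, ih, pow_one]
    rw [← ENNReal.tsum_mul_left]
    exact tsum_congr fun i => mul_left_comm _ _ _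

lemma taylorCoeff_true_nil (m n : ℕ) :
    taylorCoeff [true] m n
      = ∑' l : Fin 1 → ℕ, tupleWeight (m + 1) l * listZeta [(true, l 0 + 1)] n := by
  rw [tsum_mul_listZeta_cons _ true (fun l : Fin 1 → ℕ => l 0 + 1) (fun _ => []), taylorCoeff]
  refine tsum_congr fun j => ?_
  rw [tsum_eq_single (fun _ => m + 1) ?_]
  · simp only [taylorTerm, taylorCoeff, if_true]
    rw [Finset.sum_eq_single (m, 0) ?_ ?_]
    · simp [tupleWeight_one, listZeta]
      rw [ENNReal.inv_pow, ← pow_succ]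
    · rintro ⟨x, y⟩ hx hne
      have hx := Finset.HasAntidiagonal.mem_antidiagonal.mp hx
      rw [if_neg, mul_zero]
      rintro rfl
      exact hne (by simp_all)
    · intro h
      exact absurd (Finset.HasAntidiagonal.mem_antidiagonal.mpr (by simp)) h
  · intro l hl
    rw [tupleWeight_one, if_neg, zero_mul]
    refine fun h => hl (funext fun i => ?_)
    rw [Subsingleton.elim i 0, h]

lemma taylorCoeff_true_cons {r : ℕ} {u : List Bool} {L : (Fin (r + 1) → ℕ) → List (Bool × ℕ)}
    (h : ∀ m n, taylorCoeff u m n = ∑' l, tupleWeight (m + 1) l * listZeta (L l) n) (m n : ℕ) :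
    taylorCoeff (true :: u) m n = ∑' l : Fin (r + 1 + 1) → ℕ,
      tupleWeight (m + 1) l * listZeta ((true, l 0 + 1) :: L (fun i => l i.succ)) n := by
  rw [tsum_mul_listZeta_cons _ true (fun l : Fin (r + 1 + 1) → ℕ => l 0 + 1)
    (fun l => L (fun i => l i.succ)), taylorCoeff]
  refine tsum_congr fun j => ?_
  rw [tsum_fin_succ]
  simp only [tupleWeight_cons, Fin.cons_zero, Fin.cons_succ, if_true, taylorTerm, h]
  rw [tsum_eq_sum (s := Finset.range (m + 1)) ?_,
    Finset.Nat.sum_antidiagonal_eq_sum_range_succ (fun x y =>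
      (((n + j : ℕ) : ℝ≥0∞) + 1)⁻¹ ^ (x + 1) * ∑' l, tupleWeight (y + 1) l * listZeta (L l) (n + j))]
  · refine Finset.sum_congr rfl fun c hc => ?_
    have hc := Finset.mem_range.mp hc
    rw [← ENNReal.tsum_mul_left]
    refine tsum_congr fun l => ?_
    rw [if_pos (by omega), show m + 1 - c = m - c + 1 by omega, ENNReal.inv_pow, mul_left_comm]
  · intro c hc
    have hc : m + 1 ≤ c := by simpa using hc
    refine ENNReal.tsum_eq_zero.mpr fun l => ?_
    split_ifs with h'
    · rw [show m + 1 - c = 0 by omega, tupleWeight_zero, zero_mul]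
    · rw [zero_mul]

lemma taylorCoeff_word (ρ : List ℕ) (hne : ρ ≠ []) (m n : ℕ) :
    taylorCoeff (word ρ) m n
      = ∑' l : Fin ρ.length → ℕ, tupleWeight (m + 1) l * listZeta (blocks ρ l) n := by
  induction ρ generalizing m n with
  | nil => exact absurd rfl hne
  | cons a ρ ih =>
    rw [word]
    refine taylorCoeff_replicate_append (fun n => ?_) (a - 1) n
    cases ρ with
    | nil => exact taylorCoeff_true_nil m n
    | cons b ρ => exact taylorCoeff_true_cons (ih (by simp)) m n

/-- The nested sum `listZeta` as a single sum over tuples. -/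
noncomputable def tupleZeta (w : ℕ) (b : ℕ → Bool) (e : ℕ → ℕ) (p : ℕ) : ℝ≥0∞ :=
  ∑' n : Fin w → ℕ,
    if (∀ h : 0 < w, p < n ⟨0, h⟩) ∧
       (∀ (i : Fin w) (h : (i : ℕ) + 1 < w),
          if b i then n i ≤ n ⟨(i : ℕ) + 1, h⟩ else n i < n ⟨(i : ℕ) + 1, h⟩)
    then ∏ j : Fin w, ((n j : ℝ≥0∞) ^ e j)⁻¹ else 0

lemma cons_cond_iff {w : ℕ} (b : ℕ → Bool) (p c : ℕ) (n : Fin w → ℕ) :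
    ((∀ h : 0 < w + 1, p < (Fin.cons c n : Fin (w + 1) → ℕ) ⟨0, h⟩) ∧
       (∀ (i : Fin (w + 1)) (h : (i : ℕ) + 1 < w + 1),
          if b i then (Fin.cons c n : Fin (w + 1) → ℕ) i
              ≤ (Fin.cons c n : Fin (w + 1) → ℕ) ⟨(i : ℕ) + 1, h⟩
            else (Fin.cons c n : Fin (w + 1) → ℕ) i
              < (Fin.cons c n : Fin (w + 1) → ℕ) ⟨(i : ℕ) + 1, h⟩)) ↔
    p < c ∧ (∀ h : 0 < w, (if b 0 then c - 1 else c) < n ⟨0, h⟩) ∧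
       (∀ (i : Fin w) (h : (i : ℕ) + 1 < w),
          if b (i + 1) then n i ≤ n ⟨(i : ℕ) + 1, h⟩ else n i < n ⟨(i : ℕ) + 1, h⟩) := by
  have e : ∀ (i : ℕ) (h : i + 1 < w + 1), (Fin.cons c n : Fin (w + 1) → ℕ) ⟨i + 1, h⟩
      = n ⟨i, by omega⟩ := fun i h => Fin.cons_succ (α := fun _ => ℕ) c n ⟨i, by omega⟩
  rw [Fin.forall_fin_succ]
  simp only [Fin.cons_zero, Fin.cons_succ, Fin.val_zero, Fin.val_succ, e]
  have e0 : ∀ h : 0 < w + 1, (Fin.cons c n : Fin (w + 1) → ℕ) ⟨0, h⟩ = c := fun _ => rfl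
  simp only [e0]
  constructor
  · rintro ⟨h1, h2, h3⟩
    refine ⟨h1 (by omega), fun h => ?_, fun i h => h3 i (by omega)⟩
    have := h2 (by omega)
    have := h1 (by omega)
    split_ifs at * <;> omega
  · rintro ⟨h1, h2, h3⟩
    refine ⟨fun _ => h1, fun h => ?_, fun i h => h3 i (by omega)⟩
    have := h2 (by omega)
    split_ifs at * <;> omega

lemma tsum_ite_lt (p : ℕ) (g : ℕ → ℝ≥0∞) :
    (∑' c, if p < c then g c else 0) = ∑' j, g (p + j + 1) := by
  have hinj : Function.Injective (fun j => p + j + 1) := fun x y h => by simpa using h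
  rw [← hinj.tsum_eq]
  · refine tsum_congr fun j => ?_
    rw [if_pos (by omega)]
  · intro c hc
    have : p < c := by
      by_contra h
      simp [h] at hc
    exact ⟨c - p - 1, by simp only; omega⟩

lemma tupleZeta_succ (w : ℕ) (b : ℕ → Bool) (e : ℕ → ℕ) (p : ℕ) :
    tupleZeta (w + 1) b e p = ∑' j : ℕ, ((((p + j : ℕ) : ℝ≥0∞) + 1) ^ e 0)⁻¹
      * tupleZeta w (fun i => b (i + 1)) (fun i => e (i + 1))
        (if b 0 then p + j else p + j + 1) := by
  rw [tupleZeta, tsum_fin_succ]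
  simp only [cons_cond_iff]
  have : ∀ c, (∑' n : Fin w → ℕ, if p < c ∧ (∀ h : 0 < w, (if b 0 then c - 1 else c) < n ⟨0, h⟩) ∧
       (∀ (i : Fin w) (h : (i : ℕ) + 1 < w),
          if b (i + 1) then n i ≤ n ⟨(i : ℕ) + 1, h⟩ else n i < n ⟨(i : ℕ) + 1, h⟩)
      then ∏ j : Fin (w + 1), (((Fin.cons c n : Fin (w + 1) → ℕ) j : ℝ≥0∞) ^ e j)⁻¹ else 0)
      = if p < c then ((c : ℝ≥0∞) ^ e 0)⁻¹ * tupleZeta w (fun i => b (i + 1)) (fun i => e (i + 1))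
        (if b 0 then c - 1 else c) else 0 := by
    intro c
    by_cases h : p < c
    · simp only [h, true_and, if_true, tupleZeta, Fin.prod_univ_succ, Fin.cons_zero, Fin.cons_succ,
        Fin.val_zero, Fin.val_succ]
      rw [← ENNReal.tsum_mul_left]
      simp only [mul_ite, mul_zero]
    · simp [h]
  simp only [this]
  rw [tsum_ite_lt]
  refine tsum_congr fun j => ?_
  simp

lemma tupleZeta_eq_listZeta (L : List (Bool × ℕ)) (p : ℕ) :
    tupleZeta L.length (fun i => (L.getD i (false, 0)).1) (fun i => (L.getD i (false, 0)).2) p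
      = listZeta L p := by
  induction L generalizing p with
  | nil => simp [tupleZeta, listZeta]
  | cons x L ih =>
    rw [List.length_cons, tupleZeta_succ, listZeta]
    simp only [List.getD_cons_zero, List.getD_cons_succ, ih]

end NestedSum

section ZetaIdx

lemma map_fst_blocks (ρ : List ℕ) (l : Fin ρ.length → ℕ) :
    (blocks ρ l).map Prod.fst = word ρ := by
  induction ρ with
  | nil => rfl
  | cons a ρ ih => simp [blocks, word, ih]

lemma map_snd_blocks (ρ : List ℕ) (l : Fin ρ.length → ℕ) :
    (blocks ρ l).map Prod.snd
      = (List.ofFn fun i => List.replicate (ρ.get i - 1) 1 ++ [l i + 1]).flatten := by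
  induction ρ with
  | nil => rfl
  | cons a ρ ih =>
    simp only [blocks, List.map_append, List.map_replicate, List.map_cons, ih]
    simp [List.ofFn_succ]

lemma length_word {ρ : List ℕ} (hρ : ∀ x ∈ ρ, 0 < x) : (word ρ).length = ρ.sum := by
  induction ρ with
  | nil => rfl
  | cons a ρ ih =>
    have := hρ a List.mem_cons_self
    simp only [word, List.length_append, List.length_replicate, List.length_cons, List.sum_cons,
      ih fun x hx => hρ x (List.mem_cons_of_mem _ hx)]
    omega

lemma mem_Aset_cons {a : ℕ} {ρ : List ℕ} {x : ℕ} :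
    x ∈ Aset (a :: ρ) ↔ ρ ≠ [] ∧ (x = a ∨ ∃ y ∈ Aset ρ, a + y = x) := by
  simp only [Aset, Finset.mem_image, Finset.mem_Ico, List.length_cons, exists_exists_and_eq_and,
    ← List.length_pos_iff]
  constructor
  · rintro ⟨i, ⟨h1, h2⟩, rfl⟩
    obtain ⟨i, rfl⟩ : ∃ j, i = j + 1 := ⟨i - 1, by omega⟩
    rw [List.take_succ_cons, List.sum_cons]
    refine ⟨by omega, ?_⟩
    rcases Nat.eq_zero_or_pos i with rfl | hi
    · exact .inl (by simp)
    · exact .inr ⟨i, ⟨hi, by omega⟩, rfl⟩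
  · rintro ⟨h, rfl | ⟨i, ⟨h1, h2⟩, rfl⟩⟩
    · exact ⟨1, by omega, by simp⟩
    · exact ⟨i + 1, by omega, by simp⟩

lemma word_getD_iff {ρ : List ℕ} (hρ : ∀ x ∈ ρ, 0 < x) {i : ℕ} (hi : i + 1 < ρ.sum) :
    (word ρ).getD i false = true ↔ i + 1 ∈ Aset ρ := by
  induction ρ generalizing i with
  | nil => simp at hi
  | cons a ρ ih =>
    have ha := hρ a List.mem_cons_self
    have hρ' : ∀ x ∈ ρ, 0 < x := fun x hx => hρ x (List.mem_cons_of_mem _ hx)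
    have hA : 0 ∉ Aset ρ := by
      simp only [Aset, Finset.mem_image, Finset.mem_Ico, not_exists, not_and]
      rintro j ⟨h1, h2⟩ h
      obtain ⟨b, σ, rfl⟩ := List.exists_cons_of_length_pos (l := ρ) (by omega)
      have := hρ' b List.mem_cons_self
      obtain ⟨j, rfl⟩ : ∃ t, j = t + 1 := ⟨j - 1, by omega⟩
      rw [List.take_succ_cons, List.sum_cons] at h
      omega
    rw [List.sum_cons] at hi
    have hne : ρ ≠ [] ∨ i + 1 < a := by
      by_contra! h
      obtain ⟨rfl, h⟩ := h
      simp at hi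
      omega
    rw [word, mem_Aset_cons]
    rcases lt_trichotomy (i + 1) a with h | h | h
    · rw [List.getD_append _ _ _ _ (by simp; omega)]
      simp only [List.getD_eq_getElem?_getD, List.getElem?_replicate]
      rw [if_pos (by omega)]
      simp only [Option.getD_some, Bool.false_eq_true, false_iff]
      rintro ⟨-, h' | ⟨y, -, h'⟩⟩ <;> omega
    · rw [List.getD_append_right _ _ _ _ (by simp; omega)]
      simp only [List.length_replicate, show i - (a - 1) = 0 by omega, List.getD_cons_zero, true_iff]
      exact ⟨hne.resolve_right (by omega), .inl h⟩
    · obtain ⟨j, rfl⟩ : ∃ j, i = a + j := ⟨i - a, by omega⟩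
      rw [List.getD_append_right _ _ _ _ (by simp; omega)]
      simp only [List.length_replicate, show a + j - (a - 1) = j + 1 by omega, List.getD_cons_succ]
      rw [ih hρ' (by omega)]
      constructor
      · exact fun h' => ⟨hne.resolve_right (by omega), .inr ⟨_, h', by omega⟩⟩
      · rintro ⟨-, h' | ⟨y, hy, h'⟩⟩
        · omega
        · rwa [show j + 1 = y by omega]

lemma getD_map_fst (L : List (Bool × ℕ)) (i : ℕ) :
    (L.getD i (false, 0)).1 = (L.map Prod.fst).getD i false := by
  rw [← List.getD_map (f := Prod.fst)]

lemma getD_map_snd (L : List (Bool × ℕ)) (i : ℕ) :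
    (L.getD i (false, 0)).2 = (L.map Prod.snd).getD i 0 := by
  rw [← List.getD_map (f := Prod.snd)]

open Classical in
lemma zetaIdx_blocks {ρ : List ℕ} (hρ : ∀ x ∈ ρ, 0 < x) (l : Fin ρ.length → ℕ) :
    zetaIdx ρ (List.ofFn fun i => List.replicate (ρ.get i - 1) 1 ++ [l i + 1]).flatten
      = (listZeta (blocks ρ l) 0).toReal := by
  have hlen : (blocks ρ l).length = ρ.sum := by
    rw [← length_word hρ, ← map_fst_blocks ρ l, List.length_map]
  rw [← tupleZeta_eq_listZeta, hlen]
  simp only [getD_map_fst, getD_map_snd, map_fst_blocks, map_snd_blocks]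
  have hcond : ∀ n : Fin ρ.sum → ℕ,
      ((∀ h : 0 < ρ.sum, 0 < n ⟨0, h⟩) ∧ (∀ (i : Fin ρ.sum) (h : (i : ℕ) + 1 < ρ.sum),
          if (word ρ).getD i false = true then n i ≤ n ⟨(i : ℕ) + 1, h⟩
            else n i < n ⟨(i : ℕ) + 1, h⟩)) ↔
      ((∀ j, 0 < n j) ∧ (∀ (i : Fin ρ.sum) (h : (i : ℕ) + 1 < ρ.sum),
          if (i : ℕ) + 1 ∈ Aset ρ then n i ≤ n ⟨(i : ℕ) + 1, h⟩
          else n i < n ⟨(i : ℕ) + 1, h⟩)) := by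
    intro n
    have e : (∀ (i : Fin ρ.sum) (h : (i : ℕ) + 1 < ρ.sum),
          if (word ρ).getD i false = true then n i ≤ n ⟨(i : ℕ) + 1, h⟩
            else n i < n ⟨(i : ℕ) + 1, h⟩) ↔ (∀ (i : Fin ρ.sum) (h : (i : ℕ) + 1 < ρ.sum),
          if (i : ℕ) + 1 ∈ Aset ρ then n i ≤ n ⟨(i : ℕ) + 1, h⟩
          else n i < n ⟨(i : ℕ) + 1, h⟩) := by
      refine forall_congr' fun i => forall_congr' fun h => ?_
      simp only [word_getD_iff hρ h]
    rw [e]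
    refine and_congr_left fun hn => ⟨fun h0 => ?_, fun h0 h => h0 _⟩
    have key : ∀ (j : ℕ) (hj : j < ρ.sum), 0 < n ⟨j, hj⟩ := by
      intro j
      induction j with
      | zero => exact h0
      | succ j ih =>
        intro hj
        have h1 := ih (by omega)
        have h2 := hn ⟨j, by omega⟩ hj
        split_ifs at h2 <;> simp only at h2 <;> omega
    exact fun j => key j j.2
  unfold tupleZeta zetaIdx
  simp only [hcond]
  rw [ENNReal.tsum_toReal_eq]
  · refine tsum_congr fun n => ?_
    split_ifs with h
    · rw [ENNReal.toReal_prod]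
      refine Finset.prod_congr rfl fun j _ => ?_
      rw [ENNReal.toReal_inv, ENNReal.toReal_pow, ENNReal.toReal_natCast, one_div]
    · rfl
  · intro n
    split_ifs with h
    · refine ENNReal.prod_ne_top fun j _ => ENNReal.inv_ne_top.mpr (pow_ne_zero _ ?_)
      exact_mod_cast (h.1 j).ne'
    · simp

lemma Cm_eq {ρ : List ℕ} (hne : ρ ≠ []) (hρ : ∀ x ∈ ρ, 0 < x) (m : ℕ) :
    Cm ρ (m + 1) = (taylorCoeff (word ρ) m 0).toReal := by
  have htop := taylorCoeff_ne_top (word ρ) m 0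
  rw [taylorCoeff_word ρ hne] at htop ⊢
  rw [ENNReal.tsum_toReal_eq (fun l => ENNReal.ne_top_of_tsum_ne_top htop l)]
  have hinj : Function.Injective
      (fun (l : Fin ρ.length → Fin (m + 1 + 1)) (i : Fin ρ.length) => (l i : ℕ)) :=
    fun l l' h => funext fun i => Fin.ext (congrFun h i)
  rw [← hinj.tsum_eq, tsum_fintype, Cm]
  · refine Finset.sum_congr rfl fun l _ => ?_
    rw [zetaIdx_blocks hρ (fun i => (l i : ℕ)), tupleWeight]
    split_ifs <;> simp
  · intro l hl
    have h : ∑ i, l i = m + 1 := by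
      by_contra h
      simp [tupleWeight, h] at hl
    refine ⟨fun i => ⟨l i, ?_⟩, rfl⟩
    have := Finset.single_le_sum (f := l) (fun i _ => Nat.zero_le _) (Finset.mem_univ i)
    omega

end ZetaIdx

section HoffmanDual

lemma zipWith_sub_pos {L : List ℕ} {c : ℕ} (h : (c :: L).IsChain (· < ·)) :
    ∀ x ∈ L.zipWith (fun a b => a - b) (c :: L), 0 < x := by
  induction L generalizing c with
  | nil => simp
  | cons a L ih =>
    obtain ⟨h1, h2⟩ := List.isChain_cons_cons.mp h
    rw [List.zipWith_cons_cons]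
    intro x hx
    rcases List.mem_cons.mp hx with rfl | hx
    · omega
    · exact ih h2 x hx

lemma hdual_ne_nil (k : List ℕ) : hdual k ≠ [] := by
  rw [← List.length_pos_iff]
  simp only [hdual, List.length_zipWith, List.length_cons, Finset.length_sort]
  have := Finset.card_pos.mpr (Finset.insert_nonempty k.sum (Finset.Icc 1 (k.sum - 1) \ Aset k))
  omega

lemma hdual_pos {k : List ℕ} (hk : 0 < k.sum) : ∀ x ∈ hdual k, 0 < x := by
  refine zipWith_sub_pos ?_
  have hs := (Finset.sortedLT_sort (insert k.sum (Finset.Icc 1 (k.sum - 1) \ Aset k))).isChain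
  refine hs.cons fun x hx => ?_
  have hx := (Finset.mem_sort _).mp (List.mem_of_mem_head? hx)
  simp only [Finset.mem_insert, Finset.mem_sdiff, Finset.mem_Icc] at hx
  omega

lemma neg_one_pow_mul_cbinom (z : ℂ) (n : ℕ) :
    (-1) ^ n * cbinom z (n + 1) = z * conn z n 0 := by
  rw [cbinom, descPochhammer_eval_eq_prod_range, conn, Finset.prod_range_succ']
  have : ∏ j ∈ Finset.range n, ((j : ℂ) + 1 - z)
      = (-1) ^ n * ∏ j ∈ Finset.range n, (z - ((j + 1 : ℕ) : ℂ)) := by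
    rw [← Finset.card_range n, ← Finset.prod_const, Finset.card_range, ← Finset.prod_mul_distrib]
    refine Finset.prod_congr rfl fun j _ => ?_
    push_cast
    ring
  rw [this]
  simp
  ring

lemma F_eq_mul_connSum {k : List ℕ} (hk : k ≠ []) (hpos : ∀ x ∈ k, 0 < x) (z : ℂ) :
    F k z = z * connSum z (word (hdual k).reverse) 0 := by
  have hsum : 0 < k.sum := List.sum_pos _ hpos hk
  rw [F, if_neg hk, connSum, ← tsum_mul_left]
  refine tsum_congr fun n => ?_
  have h := sStar_reverse (hdual k).reverse (by simpa using hdual_ne_nil k)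
    (fun x hx => hdual_pos hsum x (List.mem_reverse.mp hx)) n
  rw [List.reverse_reverse] at h
  rw [h, mul_right_comm, neg_one_pow_mul_cbinom]
  ring

end HoffmanDual

/-- Taylor expansion (third form): near `z = 0`,
`F_k(z) = Σ_{m=1}^∞ (-1)^{m-1} C_m(rev(k∨)) z^m`. -/
theorem F_taylor_three (k : List ℕ) (hk : k ≠ []) (hpos : ∀ x ∈ k, 0 < x) :
    ∀ᶠ z : ℂ in 𝓝 0,
      F k z = ∑' m : ℕ,
        (-1 : ℂ) ^ m * ((Cm ((hdual k).reverse) (m + 1) : ℝ) : ℂ) * z ^ (m + 1) := by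
  have hsum : 0 < k.sum := List.sum_pos _ hpos hk
  filter_upwards [Metric.closedBall_mem_nhds (0 : ℂ) (show (0 : ℝ) < 1 / 4 by norm_num)] with z hz
  rw [mem_closedBall_zero_iff] at hz
  rw [F_eq_mul_connSum hk hpos, ← ((hasSum_taylorCoeff hz _ 0).mul_left z).tsum_eq]
  refine tsum_congr fun m => ?_
  rw [Cm_eq (by simpa using hdual_ne_nil k)
    (fun x hx => hdual_pos hsum x (List.mem_reverse.mp hx)), neg_pow, pow_succ]
  ring

end Kawashima
end

section
/- (Harmonic relation for Kawashima functions.) For any indices k and l and any z∈ℂ with Re(z)>−1, F_k(z)·F_l(z) = F_{k *̄ l}(z), where *̄ is the harmonic (stuffle-with-minus) product and F is extended ℚ-linearly to linear combinations of indices, with F_∅(z)=1. -/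
open MeasureTheory Filter Topology

namespace Kawashima

/-- The reversed index encoded by a word: `true` increments the last entry of the index,
`false` appends a new entry `1`. -/
def ofWord : List Bool → List ℕ
  | [] => [1]
  | true :: w => (ofWord w).modifyHead (· + 1)
  | false :: w => 1 :: ofWord w

theorem exists_ofWord_eq_cons (w : List Bool) : ∃ a j, ofWord w = a :: j := by
  induction w with
  | nil => exact ⟨1, [], rfl⟩
  | cons b w ih =>
    obtain ⟨a, j, h⟩ := ih
    cases b
    · exact ⟨1, ofWord w, rfl⟩
    · exact ⟨a + 1, j, by simp [ofWord, h]⟩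

theorem ofWord_true {w : List Bool} {a : ℕ} {j : List ℕ} (h : ofWord w = a :: j) :
    ofWord (true :: w) = (a + 1) :: j := by
  simp [ofWord, h]

theorem ofWord_pos (w : List Bool) : ∀ x ∈ ofWord w, 0 < x := by
  induction w with
  | nil => simp [ofWord]
  | cons b w ih =>
    cases b
    · simpa [ofWord] using ih
    · obtain ⟨a, j, h⟩ := exists_ofWord_eq_cons w
      rw [h] at ih
      rw [ofWord_true h]
      simp_all

theorem exists_ofWord_eq {j : List ℕ} (hj : j ≠ []) (hpos : ∀ x ∈ j, 0 < x) :
    ∃ w, ofWord w = j := by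
  have key : ∀ (a : ℕ) (j : List ℕ), (∃ w, ofWord w = 1 :: j) →
      ∃ w, ofWord w = (a + 1) :: j := by
    intro a j h
    induction a with
    | zero => exact h
    | succ a ih =>
      obtain ⟨w, hw⟩ := ih
      exact ⟨true :: w, ofWord_true hw⟩
  induction j with
  | nil => exact absurd rfl hj
  | cons a j ih =>
    obtain ⟨b, rfl⟩ : ∃ b, a = b + 1 := ⟨a - 1, by have := hpos a (by simp); omega⟩
    apply key
    by_cases h : j = []
    · exact ⟨[], by simp [ofWord, h]⟩
    · obtain ⟨w, hw⟩ := ih h (fun x hx => hpos x (by simp [hx]))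
      exact ⟨false :: w, by simp [ofWord, hw]⟩

theorem sum_ofWord (w : List Bool) : (ofWord w).sum = w.length + 1 := by
  induction w with
  | nil => simp [ofWord]
  | cons b w ih =>
    cases b
    · simp [ofWord, ih]; omega
    · obtain ⟨a, j, h⟩ := exists_ofWord_eq_cons w
      rw [h] at ih
      rw [ofWord_true h]
      simp at ih ⊢
      omega

theorem mem_Aset {k : List ℕ} {x : ℕ} :
    x ∈ Aset k ↔ ∃ i, 1 ≤ i ∧ i < k.length ∧ (k.take i).sum = x := by
  simp [Aset, and_assoc]

theorem Aset_append_singleton {k : List ℕ} (hk : k ≠ []) (a : ℕ) :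
    Aset (k ++ [a]) = insert k.sum (Aset k) := by
  have hlen : 1 ≤ k.length := List.length_pos_iff.2 hk
  ext x
  simp only [mem_Aset, Finset.mem_insert, List.length_append, List.length_singleton]
  constructor
  · rintro ⟨i, h1, h2, rfl⟩
    rcases Nat.lt_succ_iff_lt_or_eq.1 h2 with h | rfl
    · exact Or.inr ⟨i, h1, h, by rw [List.take_append_of_le_length h.le]⟩
    · left; simp
  · rintro (rfl | ⟨i, h1, h2, rfl⟩)
    · exact ⟨k.length, hlen, by omega, by simp⟩
    · exact ⟨i, h1, by omega, by rw [List.take_append_of_le_length h2.le]⟩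

theorem Aset_append_singleton_congr (k : List ℕ) (a b : ℕ) :
    Aset (k ++ [a]) = Aset (k ++ [b]) := by
  by_cases hk : k = []
  · subst hk; rfl
  · rw [Aset_append_singleton hk, Aset_append_singleton hk]

theorem Aset_ofWord_true (w : List Bool) :
    Aset (ofWord (true :: w)).reverse = Aset (ofWord w).reverse := by
  obtain ⟨a, j, h⟩ := exists_ofWord_eq_cons w
  rw [ofWord_true h, h]
  simpa using Aset_append_singleton_congr j.reverse (a + 1) a

theorem Aset_ofWord_false (w : List Bool) :
    Aset (ofWord (false :: w)).reverse =
      insert (w.length + 1) (Aset (ofWord w).reverse) := by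
  obtain ⟨a, j, h⟩ := exists_ofWord_eq_cons w
  have hne : (ofWord w).reverse ≠ [] := by simp [h]
  simp [ofWord, Aset_append_singleton hne, sum_ofWord]

theorem Aset_ofWord_subset (w : List Bool) :
    Aset (ofWord w).reverse ⊆ Finset.Icc 1 w.length := by
  induction w with
  | nil => simp [ofWord, Aset]
  | cons b w ih =>
    have hmono : Finset.Icc 1 w.length ⊆ Finset.Icc 1 (w.length + 1) :=
      Finset.Icc_subset_Icc_right (by omega)
    cases b
    · rw [Aset_ofWord_false]
      exact Finset.insert_subset (by simp) (ih.trans hmono)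
    · rw [Aset_ofWord_true]
      exact ih.trans hmono

theorem Aset_ofWord_not (w : List Bool) :
    Finset.Icc 1 w.length \ Aset (ofWord w).reverse =
      Aset (ofWord (w.map not)).reverse := by
  induction w with
  | nil => simp [ofWord, Aset]
  | cons b w ih =>
    have hsub : w.length + 1 ∉ Aset (ofWord w).reverse := fun h => by
      have := Aset_ofWord_subset w h
      simp at this
    have hIcc : Finset.Icc 1 (w.length + 1) = insert (w.length + 1) (Finset.Icc 1 w.length) := by
      ext x; simp; omega
    cases b
    · simp only [List.map_cons, Bool.not_false, List.length_cons]
      rw [Aset_ofWord_true, Aset_ofWord_false, ← ih, hIcc, Finset.insert_sdiff_insert,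
        Finset.sdiff_insert_of_notMem (by simp)]
    · simp only [List.map_cons, Bool.not_true, List.length_cons]
      rw [Aset_ofWord_true, Aset_ofWord_false, ← ih, hIcc, Finset.insert_sdiff_of_notMem _ hsub]
      simp

/-- The partial sums of a list, shifted by `s`. -/
def partialSums : ℕ → List ℕ → List ℕ
  | _, [] => []
  | s, a :: h => (s + a) :: partialSums (s + a) h

theorem mem_partialSums {h : List ℕ} {s x : ℕ} :
    x ∈ partialSums s h ↔ ∃ i, 1 ≤ i ∧ i ≤ h.length ∧ s + (h.take i).sum = x := by
  induction h generalizing s with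
  | nil =>
    simp only [partialSums, List.not_mem_nil, List.length_nil, false_iff, not_exists]
    omega
  | cons a h ih =>
    simp only [partialSums, List.mem_cons, ih, List.length_cons]
    constructor
    · rintro (rfl | ⟨i, h1, h2, rfl⟩)
      · exact ⟨1, le_rfl, by omega, by simp⟩
      · exact ⟨i + 1, by omega, by omega, by simp [add_assoc]⟩
    · rintro ⟨i, h1, h2, rfl⟩
      obtain ⟨i, rfl⟩ : ∃ i', i = i' + 1 := ⟨i - 1, by omega⟩
      rcases Nat.eq_zero_or_pos i with rfl | hi
      · left; simp
      · exact Or.inr ⟨i, hi, by omega, by simp; omega⟩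

theorem pairwise_partialSums {h : List ℕ} (hpos : ∀ x ∈ h, 0 < x) (s : ℕ) :
    (∀ x ∈ partialSums s h, s < x) ∧ (partialSums s h).Pairwise (· < ·) := by
  induction h generalizing s with
  | nil => simp [partialSums]
  | cons a h ih =>
    have ha := hpos a (by simp)
    obtain ⟨h1, h2⟩ := ih (fun x hx => hpos x (by simp [hx])) (s + a)
    refine ⟨?_, ?_⟩
    · intro x hx
      rcases List.mem_cons.1 hx with rfl | hx
      · omega
      · have := h1 x hx
        omega
    · exact List.pairwise_cons.2 ⟨h1, h2⟩

theorem zipWith_sub_partialSums (h : List ℕ) (s : ℕ) :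
    (partialSums s h).zipWith (fun a b => a - b) (s :: partialSums s h) = h := by
  induction h generalizing s with
  | nil => simp [partialSums]
  | cons a h ih => simpa [partialSums] using ih (s + a)

theorem sort_insert_Aset {h : List ℕ} (hne : h ≠ []) (hpos : ∀ x ∈ h, 0 < x) :
    (insert h.sum (Aset h)).sort (· ≤ ·) = partialSums 0 h := by
  have hp := (pairwise_partialSums hpos 0).2
  have hlen : 1 ≤ h.length := List.length_pos_iff.2 hne
  have : insert h.sum (Aset h) = (partialSums 0 h).toFinset := by
    ext x
    simp only [Finset.mem_insert, mem_Aset, List.mem_toFinset, mem_partialSums, zero_add]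
    constructor
    · rintro (rfl | ⟨i, h1, h2, rfl⟩)
      · exact ⟨h.length, hlen, le_rfl, by simp⟩
      · exact ⟨i, h1, h2.le, rfl⟩
    · rintro ⟨i, h1, h2, rfl⟩
      rcases h2.lt_or_eq with h2 | rfl
      · exact Or.inr ⟨i, h1, h2, rfl⟩
      · left; simp
  rw [this, List.toFinset_sort _ (hp.imp fun h => h.ne)]
  exact hp.imp fun h => h.le

theorem hdual_ofWord (w : List Bool) :
    hdual (ofWord w).reverse = (ofWord (w.map not)).reverse := by
  obtain ⟨a, j, h⟩ := exists_ofWord_eq_cons (w.map not)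
  have hs : (ofWord w).reverse.sum = (ofWord (w.map not)).reverse.sum := by
    simp [sum_ofWord]
  have hw : (ofWord (w.map not)).reverse.sum - 1 = w.length := by simp [sum_ofWord]
  simp only [hdual, hs, hw, Aset_ofWord_not]
  rw [sort_insert_Aset (by simp [h]) (by simpa using ofWord_pos (w.map not))]
  exact zipWith_sub_partialSums _ 0

/-- Multiplication of a table by the reciprocal of the second coordinate, extended to the whole
table compatibly with the relation `c (m + 1) n + c m (n + 1) = c m n`. -/
noncomputable def divTable (c : ℕ → ℕ → ℝ) : ℕ → ℕ → ℝ
  | 0, n => c 0 n / (n + 1)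
  | m + 1, n => (c (m + 1) n + (m + 1) * divTable c m n) / (m + n + 2)

/-- The difference table whose row `0` is `n ↦ s⋆(k, n + 1)` and whose column `0` is
`n ↦ s⋆(k∨, n + 1)`, where `k` is the index encoded by the word. -/
noncomputable def table : List Bool → ℕ → ℕ → ℝ
  | [] => fun m n => (m.factorial * n.factorial : ℝ) / (m + n + 1).factorial
  | true :: w => divTable (table w)
  | false :: w => fun m n => divTable (fun i j => table w j i) n m

theorem divTable_pascal {c : ℕ → ℕ → ℝ} (hc : ∀ m n, c (m + 1) n + c m (n + 1) = c m n)
    (m n : ℕ) : divTable c (m + 1) n + divTable c m (n + 1) = divTable c m n := by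
  induction m generalizing n with
  | zero =>
    have h := hc 0 n
    simp only [divTable]
    rw [← h]
    push_cast
    field_simp
    ring
  | succ m ih =>
    have h := hc (m + 1) n
    have h2 := ih n
    have e1 : (m + n + 2 : ℝ) * divTable c (m + 1) n =
        c (m + 1) n + (m + 1) * divTable c m n := by
      rw [divTable]; field_simp
    have e2 : divTable c (m + 1) (n + 1) =
        (c (m + 1) (n + 1) + (m + 1) * divTable c m (n + 1)) / (m + n + 3) := by
      rw [divTable]; push_cast; ring
    have e3 : divTable c (m + 1 + 1) n =
        (c (m + 1 + 1) n + (m + 2) * divTable c (m + 1) n) / (m + n + 3) := by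
      rw [divTable]; push_cast; ring
    rw [e2, e3, ← add_div, div_eq_iff (by positivity)]
    linear_combination h - e1 + (m + 1 : ℝ) * h2

theorem divTable_nonneg {c : ℕ → ℕ → ℝ} (hc : ∀ m n, 0 ≤ c m n) (m n : ℕ) :
    0 ≤ divTable c m n := by
  induction m with
  | zero => have := hc 0 n; rw [divTable]; positivity
  | succ m ih => have := hc (m + 1) n; rw [divTable]; positivity

theorem table_pascal (w : List Bool) (m n : ℕ) :
    table w (m + 1) n + table w m (n + 1) = table w m n := by
  induction w generalizing m n with
  | nil =>
    have e1 : m + 1 + n + 1 = (m + n + 1) + 1 := by ring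
    have e2 : m + (n + 1) + 1 = (m + n + 1) + 1 := by ring
    simp only [table, e1, e2, Nat.factorial_succ (m + n + 1), Nat.factorial_succ m,
      Nat.factorial_succ n]
    have : ((m + n + 1).factorial : ℝ) ≠ 0 := by positivity
    push_cast
    field_simp
    ring
  | cons b w ih =>
    cases b
    · have := divTable_pascal (c := fun i j => table w j i)
        (fun i j => by simpa only [add_comm] using ih j i) n m
      simp only [table]
      linarith
    · exact divTable_pascal ih m n

theorem table_nonneg (w : List Bool) (m n : ℕ) : 0 ≤ table w m n := by
  induction w generalizing m n with
  | nil => simp only [table]; positivity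
  | cons b w ih =>
    cases b
    · exact divTable_nonneg (fun i j => ih j i) n m
    · exact divTable_nonneg ih m n

theorem table_map_not (w : List Bool) (m n : ℕ) : table (w.map not) m n = table w n m := by
  induction w generalizing m n with
  | nil => simp only [List.map_nil, table, add_comm m n, mul_comm]
  | cons b w ih =>
    have h : table (w.map not) = fun i j => table w j i := funext₂ ih
    cases b <;> simp [table, h]

theorem table_le_left (w : List Bool) (m n : ℕ) : table w m n ≤ table w m 0 := by
  induction n with
  | zero => exact le_rfl
  | succ n ih => linarith [table_pascal w m n, table_nonneg w (m + 1) n]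

theorem table_le_right (w : List Bool) (m n : ℕ) : table w m n ≤ table w 0 n := by
  induction m with
  | zero => exact le_rfl
  | succ m ih => linarith [table_pascal w m n, table_nonneg w m (n + 1)]

theorem table_true_zero (w : List Bool) (n : ℕ) :
    table (true :: w) 0 n = table w 0 n / (n + 1) := rfl

theorem table_false_zero (w : List Bool) (n : ℕ) :
    table (false :: w) 0 n = (∑ i ∈ Finset.range (n + 1), table w 0 i) / (n + 1) := by
  induction n with
  | zero => simp [table, divTable]
  | succ n ih =>
    have e : table (false :: w) 0 (n + 1) =
        (table w 0 (n + 1) + (n + 1) * table (false :: w) 0 n) / (n + 2) := by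
      simp [table, divTable]
    rw [e, ih, Finset.sum_range_succ _ (n + 1)]
    push_cast
    field_simp
    ring

theorem table_nil_zero (n : ℕ) : table [] 0 n = 1 / (n + 1) := by
  simp only [table, Nat.factorial_zero, zero_add, Nat.factorial_succ]
  push_cast
  field_simp

/-- The sum `W = Σ 1/(m₁^{k₁} ⋯ m_r^{k_r})` over `0 < m₁ ≤ ⋯ ≤ m_r ≤ N`, with all variables
bounded by `B`. -/
noncomputable def boundedSum (k : List ℕ) (B N : ℕ) : ℝ :=
  ∑ m : Fin k.length → Fin (B + 1),
    if (∀ i, 0 < (m i : ℕ)) ∧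
       (∀ i j : Fin k.length, i ≤ j → (m i : ℕ) ≤ (m j : ℕ)) ∧
       (∀ i : Fin k.length, (m i : ℕ) ≤ N)
    then ∏ i : Fin k.length, 1 / ((m i : ℕ) : ℝ) ^ k.get i
    else 0

/-- The sum defining `sStar k N`, with all variables bounded by `B` instead of `N`. -/
noncomputable def boundedStar (k : List ℕ) (B N : ℕ) : ℝ :=
  ∑ m : Fin k.length → Fin (B + 1),
    if (∀ i, 0 < (m i : ℕ)) ∧
       (∀ i j : Fin k.length, i ≤ j → (m i : ℕ) ≤ (m j : ℕ)) ∧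
       (∀ i : Fin k.length, (i : ℕ) + 1 = k.length → (m i : ℕ) = N)
    then ∏ i : Fin k.length, 1 / ((m i : ℕ) : ℝ) ^ k.get i
    else 0

theorem boundedSum_nil (B N : ℕ) : boundedSum [] B N = 1 := by
  simp [boundedSum]

theorem boundedSum_eq_sum_boundedStar {k : List ℕ} (hk : k ≠ []) (B N : ℕ) :
    boundedSum k B N = ∑ n ∈ Finset.Icc 1 N, boundedStar k B n := by
  have hlen : 0 < k.length := List.length_pos_iff.2 hk
  simp only [boundedSum, boundedStar]
  rw [Finset.sum_comm]
  refine Finset.sum_congr rfl fun m _ => ?_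
  set last : Fin k.length := ⟨k.length - 1, by omega⟩
  have hlast : ∀ n, (∀ i : Fin k.length, (i : ℕ) + 1 = k.length → (m i : ℕ) = n) ↔
      n = (m last : ℕ) := by
    intro n
    constructor
    · intro h
      exact (h last (by simp [last]; omega)).symm
    · rintro rfl i hi
      have : i = last := Fin.ext (by simp [last]; omega)
      rw [this]
  simp only [hlast]
  by_cases h : (∀ i, 0 < (m i : ℕ)) ∧ (∀ i j : Fin k.length, i ≤ j → (m i : ℕ) ≤ (m j : ℕ))
  · obtain ⟨h1, h2⟩ := h
    have hle : (∀ i : Fin k.length, (m i : ℕ) ≤ N) ↔ (m last : ℕ) ∈ Finset.Icc 1 N := by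
      rw [Finset.mem_Icc]
      constructor
      · intro h
        exact ⟨h1 _, h _⟩
      · intro h i
        exact (h2 i last (Fin.le_def.2 (by have := i.2; simp [last]; omega))).trans h.2
    simp only [eq_true h1, eq_true h2, hle, true_and]
    rw [Finset.sum_ite_eq']
  · rw [if_neg (fun h' => h ⟨h'.1, h'.2.1⟩)]
    exact (Finset.sum_eq_zero fun n _ => if_neg (fun h' => h ⟨h'.1, h'.2.1⟩)).symm

theorem boundedStar_eq_of_length {k : List ℕ} {r : ℕ} (h : k.length = r) (B N : ℕ) :
    boundedStar k B N = ∑ m : Fin r → Fin (B + 1),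
      if (∀ i, 0 < (m i : ℕ)) ∧ (∀ i j : Fin r, i ≤ j → (m i : ℕ) ≤ (m j : ℕ)) ∧
         (∀ i : Fin r, (i : ℕ) + 1 = r → (m i : ℕ) = N)
      then ∏ i : Fin r, 1 / ((m i : ℕ) : ℝ) ^ k.get (i.cast h.symm)
      else 0 := by
  subst h
  rfl

theorem boundedStar_append_singleton (k : List ℕ) (a : ℕ) {B N : ℕ} (hN : 0 < N) (hB : N ≤ B) :
    boundedStar (k ++ [a]) B N = boundedSum k B N / (N : ℝ) ^ a := by
  rw [boundedStar_eq_of_length (r := k.length + 1) (by simp),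
    ← (Fin.snocEquiv fun _ => Fin (B + 1)).sum_comp, Fintype.sum_prod_type,
    Finset.sum_eq_single (⟨N, by omega⟩ : Fin (B + 1))]
  · rw [boundedSum, Finset.sum_div]
    refine Finset.sum_congr rfl fun m _ => ?_
    have hcond : (∀ i, 0 < ((Fin.snocEquiv fun _ => Fin (B + 1)) (⟨N, by omega⟩, m) i : ℕ)) ∧
        (∀ i j : Fin (k.length + 1), i ≤ j →
          ((Fin.snocEquiv fun _ => Fin (B + 1)) (⟨N, by omega⟩, m) i : ℕ) ≤
            ((Fin.snocEquiv fun _ => Fin (B + 1)) (⟨N, by omega⟩, m) j : ℕ)) ∧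
        (∀ i : Fin (k.length + 1), (i : ℕ) + 1 = k.length + 1 →
          ((Fin.snocEquiv fun _ => Fin (B + 1)) (⟨N, by omega⟩, m) i : ℕ) = N) ↔
        (∀ i, 0 < (m i : ℕ)) ∧ (∀ i j : Fin k.length, i ≤ j → (m i : ℕ) ≤ (m j : ℕ)) ∧
          (∀ i : Fin k.length, (m i : ℕ) ≤ N) := by
      have hle : ∀ i : Fin k.length, ¬ (Fin.last k.length ≤ i.castSucc) := fun i => by simp
      have hlast : ∀ i : Fin k.length, (i : ℕ) ≠ k.length := fun i => i.2.ne
      have hN' : (0 : Fin (B + 1)) < ⟨N, by omega⟩ := Fin.lt_def.2 (by simpa using hN)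
      simp [Fin.forall_fin_succ', Fin.snocEquiv, hN', hlast, hle, Fin.le_last, forall_and,
        Fin.castSucc_le_castSucc_iff]
      simp only [Fin.le_def, implies_true]
    simp only [hcond]
    split_ifs with h
    · rw [Fin.prod_univ_castSucc]
      simp [Fin.snocEquiv, div_eq_mul_inv]
    · simp
  · intro b _ hb
    refine Finset.sum_eq_zero fun m _ => if_neg fun h => hb (Fin.ext ?_)
    simpa [Fin.snocEquiv] using h.2.2 (Fin.last _) (by simp)
  · simp

theorem boundedStar_ofWord (w : List Bool) {B n : ℕ} (hB : n + 1 ≤ B) :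
    boundedStar (ofWord w).reverse B (n + 1) = table w 0 n := by
  induction w generalizing n with
  | nil =>
    rw [table_nil_zero]
    simpa [ofWord, boundedSum_nil] using boundedStar_append_singleton [] 1 n.succ_pos hB
  | cons b w ih =>
    obtain ⟨a, j, h⟩ := exists_ofWord_eq_cons w
    cases b
    · have hne : (ofWord w).reverse ≠ [] := by simp [h]
      have e : (ofWord (false :: w)).reverse = (ofWord w).reverse ++ [1] := by simp [ofWord]
      rw [e, boundedStar_append_singleton _ _ n.succ_pos hB,
        boundedSum_eq_sum_boundedStar hne, table_false_zero,
        Finset.range_eq_Ico, ← Finset.Ico_add_one_right_eq_Icc,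
        ← zero_add 1, ← Finset.sum_Ico_add']
      rw [Finset.sum_congr rfl fun i hi => ih (n := i) (by simp at hi; omega)]
      simp
    · have ih' := ih hB
      rw [h, List.reverse_cons, boundedStar_append_singleton _ _ n.succ_pos hB] at ih'
      rw [ofWord_true h, List.reverse_cons, boundedStar_append_singleton _ _ n.succ_pos hB,
        table_true_zero, ← ih', pow_succ]
      push_cast
      rw [div_div]

theorem sStar_hdual_ofWord (w : List Bool) (n : ℕ) :
    sStar (hdual (ofWord w).reverse) (n + 1) = table w n 0 := by
  rw [hdual_ofWord, ← table_map_not]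
  exact boundedStar_ofWord (w.map not) le_rfl

theorem cbinom_zero (z : ℂ) : cbinom z 0 = 1 := by simp [cbinom]

theorem cbinom_succ (z : ℂ) (n : ℕ) : cbinom z (n + 1) = cbinom z n * (z - n) / (n + 1) := by
  have h : (n.factorial : ℂ) ≠ 0 := by exact_mod_cast n.factorial_ne_zero
  have h' : (n + 1 : ℂ) ≠ 0 := by exact_mod_cast n.succ_ne_zero
  simp only [cbinom, descPochhammer_succ_right, Nat.factorial_succ]
  simp only [Polynomial.eval_mul, Polynomial.eval_sub, Polynomial.eval_X,
    Polynomial.eval_natCast]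
  push_cast
  field_simp

theorem mul_cbinom_sub_one (z : ℂ) (n : ℕ) :
    z * cbinom (z - 1) n = (n + 1) * cbinom z (n + 1) := by
  induction n with
  | zero => simp [cbinom_succ, cbinom_zero]
  | succ n ih =>
    have h' : (n + 1 : ℂ) ≠ 0 := by exact_mod_cast n.succ_ne_zero
    have h'' : (n + 1 + 1 : ℂ) ≠ 0 := by exact_mod_cast (n + 1).succ_ne_zero
    rw [cbinom_succ (z - 1), cbinom_succ z (n + 1)]
    push_cast
    field_simp
    linear_combination (z - 1 - n) * ih

theorem cbinom_pascal (z : ℂ) (n : ℕ) :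
    cbinom z (n + 1) = cbinom (z - 1) n + cbinom (z - 1) (n + 1) := by
  have h' : (n + 1 : ℂ) ≠ 0 := by exact_mod_cast n.succ_ne_zero
  rw [cbinom_succ (z - 1), ← mul_right_inj' h', ← mul_cbinom_sub_one]
  field_simp
  ring

theorem cbinom_zero_succ (n : ℕ) : cbinom 0 (n + 1) = 0 := by
  induction n with
  | zero => simp [cbinom_succ]
  | succ n ih => rw [cbinom_succ, ih]; simp

theorem norm_cbinom_le {z : ℂ} {s : ℝ} (hs0 : 0 ≤ s) (hs : s < 1 + z.re) :
    ∃ C, 0 ≤ C ∧ ∀ n : ℕ, ‖cbinom z n‖ ≤ C * (n + 1 : ℝ) ^ (-s) := by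
  set u : ℕ → ℝ := fun n => ‖cbinom z n‖ * (n + 1 : ℝ) ^ s
  have hu0 : ∀ n, 0 ≤ u n := fun n => by positivity
  obtain ⟨N, hN⟩ := exists_nat_ge (max s ((‖z‖ ^ 2) / (2 * (1 + z.re - s))))
  have hstep : ∀ n, N ≤ n → u (n + 1) ≤ u n := by
    intro n hn
    have hn' : (N : ℝ) ≤ n := by exact_mod_cast hn
    have hsn : s ≤ n := (le_max_left _ _).trans (hN.trans hn')
    have hzn : ‖z‖ ^ 2 ≤ n * (2 * (1 + z.re - s)) :=
      (div_le_iff₀ (by linarith)).1 ((le_max_right _ _).trans (hN.trans hn'))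
    have hz : ‖z - n‖ ≤ n + 1 - s := by
      refine le_of_sq_le_sq ?_ (by linarith)
      have h1 : ‖z - n‖ ^ 2 = ‖z‖ ^ 2 - 2 * n * z.re + n ^ 2 := by
        rw [← Complex.normSq_eq_norm_sq, ← Complex.normSq_eq_norm_sq, Complex.normSq_apply,
          Complex.normSq_apply]
        simp
        ring
      rw [h1]
      nlinarith [sq_nonneg (1 - s)]
    have hpos : (0 : ℝ) < n + 1 := by positivity
    have h1 : ‖z - n‖ / (n + 1) ≤ Real.exp (-(s / (n + 1))) := by
      refine le_trans ?_ (Real.add_one_le_exp _)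
      rw [div_le_iff₀ hpos]
      field_simp
      linarith
    have h2 : (n + 1 + 1 : ℝ) ^ s ≤ (n + 1 : ℝ) ^ s * Real.exp (s / (n + 1)) := by
      have e : (n + 1 + 1 : ℝ) = (n + 1) * (1 / (n + 1) + 1) := by field_simp; ring
      rw [e, Real.mul_rpow hpos.le (by positivity)]
      gcongr
      calc (1 / (n + 1) + 1 : ℝ) ^ s ≤ (Real.exp (1 / (n + 1))) ^ s := by
            gcongr
            exact Real.add_one_le_exp _
        _ = Real.exp (s / (n + 1)) := by
            rw [← Real.exp_mul]
            congr 1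
            ring
    have h3 : ‖(n + 1 : ℂ)‖ = n + 1 := by
      rw [← Nat.cast_succ, Complex.norm_natCast, Nat.cast_succ]
    calc u (n + 1) = ‖cbinom z n‖ * ((‖z - n‖ / (n + 1)) * (n + 1 + 1 : ℝ) ^ s) := by
          simp only [u, cbinom_succ, norm_div, norm_mul, h3]
          push_cast
          ring
      _ ≤ ‖cbinom z n‖ *
          (Real.exp (-(s / (n + 1))) * ((n + 1 : ℝ) ^ s * Real.exp (s / (n + 1)))) := by
          gcongr
      _ = u n := by
          simp only [u, Real.exp_neg]
          field_simp
  have hbound : ∀ n, u n ≤ ∑ i ∈ Finset.range (N + 1), u i := by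
    intro n
    rcases le_total n N with h | h
    · exact Finset.single_le_sum (fun i _ => hu0 i) (Finset.mem_range.2 (by omega))
    · induction n, h using Nat.le_induction with
      | base => exact Finset.single_le_sum (fun i _ => hu0 i) (Finset.mem_range.2 (by omega))
      | succ n hn ih => exact (hstep n hn).trans ih
  refine ⟨∑ i ∈ Finset.range (N + 1), u i, Finset.sum_nonneg fun i _ => hu0 i, fun n => ?_⟩
  have hpos : (0 : ℝ) < n + 1 := by positivity
  rw [Real.rpow_neg hpos.le, ← div_eq_mul_inv, le_div_iff₀ (by positivity)]
  exact hbound n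

theorem sum_rpow_sub_one_le {ε : ℝ} (h0 : 0 < ε) (h1 : ε ≤ 1) (n : ℕ) :
    ∑ i ∈ Finset.range n, (i + 1 : ℝ) ^ (ε - 1) ≤ (n : ℝ) ^ ε / ε := by
  induction n with
  | zero => simp [Real.zero_rpow h0.ne']
  | succ n ih =>
    have hpos : (0 : ℝ) < n + 1 := by positivity
    have hb := rpow_one_add_le_one_add_mul_self (s := -1 / (n + 1 : ℝ))
      (by rw [le_div_iff₀ hpos]; linarith) h0.le h1
    have e : (n : ℝ) = (n + 1) * (1 + -1 / (n + 1)) := by field_simp; ring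
    have e2 : (n : ℝ) ^ ε = (n + 1 : ℝ) ^ ε * (1 + -1 / (n + 1)) ^ ε := by
      conv_lhs => rw [e]
      refine Real.mul_rpow hpos.le ?_
      have : 1 + -1 / (n + 1 : ℝ) = n / (n + 1) := by field_simp; ring
      rw [this]
      positivity
    have e3 : (n : ℝ) ^ ε ≤ (n + 1 : ℝ) ^ ε * (1 + ε * (-1 / (n + 1))) := by
      rw [e2]; gcongr
    rw [Finset.sum_range_succ, Real.rpow_sub_one hpos.ne']
    push_cast
    calc _ ≤ (n + 1 : ℝ) ^ ε * (1 + ε * (-1 / (n + 1))) / ε + (n + 1 : ℝ) ^ ε / (n + 1) := by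
          gcongr
          exact ih.trans (by gcongr)
      _ = _ := by field_simp; ring

theorem table_zero_le (w : List Bool) {ε : ℝ} (hε : 0 < ε) :
    ∃ C, 0 ≤ C ∧ ∀ n : ℕ, table w 0 n ≤ C * (n + 1 : ℝ) ^ (ε - 1) := by
  wlog h1 : ε ≤ 1 generalizing ε
  · obtain ⟨C, hC, h⟩ := this one_pos le_rfl
    refine ⟨C, hC, fun n => (h n).trans ?_⟩
    gcongr
    · linarith [n.cast_nonneg (α := ℝ)]
    · linarith
  induction w with
  | nil =>
    refine ⟨1, zero_le_one, fun n => ?_⟩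
    have hpos : (1 : ℝ) ≤ n + 1 := by linarith [n.cast_nonneg (α := ℝ)]
    rw [table_nil_zero, one_mul, one_div, ← Real.rpow_neg_one]
    exact Real.rpow_le_rpow_of_exponent_le hpos (by linarith)
  | cons b w ih =>
    obtain ⟨C, hC, h⟩ := ih
    cases b
    · refine ⟨C / ε, by positivity, fun n => ?_⟩
      have hpos : (0 : ℝ) < n + 1 := by positivity
      rw [table_false_zero, Real.rpow_sub_one hpos.ne', ← mul_div_assoc]
      gcongr
      calc _ ≤ ∑ i ∈ Finset.range (n + 1), C * (i + 1 : ℝ) ^ (ε - 1) :=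
            Finset.sum_le_sum fun i _ => h i
        _ = C * ∑ i ∈ Finset.range (n + 1), (i + 1 : ℝ) ^ (ε - 1) := by rw [Finset.mul_sum]
        _ ≤ C * (((n + 1 : ℕ) : ℝ) ^ ε / ε) := by
            gcongr
            exact sum_rpow_sub_one_le hε h1 _
        _ = _ := by push_cast; ring
    · refine ⟨C, hC, fun n => (div_le_self (table_nonneg w 0 n) ?_).trans (h n)⟩
      linarith [n.cast_nonneg (α := ℝ)]

theorem sum_table_zero_le (w : List Bool) {ε : ℝ} (hε : 0 < ε) :
    ∃ C, 0 ≤ C ∧ ∀ n : ℕ, ∑ i ∈ Finset.range n, table w 0 i ≤ C * (n + 1 : ℝ) ^ ε := by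
  obtain ⟨C, hC, h⟩ := table_zero_le (false :: w) hε
  refine ⟨C, hC, fun n => ?_⟩
  have hpos : (0 : ℝ) < n + 1 := by positivity
  have h' := h n
  rw [table_false_zero, Real.rpow_sub_one hpos.ne', ← mul_div_assoc,
    div_le_div_iff_of_pos_right hpos, Finset.sum_range_succ] at h'
  linarith [table_nonneg w 0 n]

theorem summable_newton {a : ℕ → ℝ} {z : ℂ} {C ε : ℝ} (hε0 : 0 ≤ ε) (hε : ε < 1 + z.re)
    (ha : ∀ n : ℕ, |a n| ≤ C * (n + 1 : ℝ) ^ (ε - 1)) :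
    Summable (fun n : ℕ => (-1 : ℂ) ^ n * (a n : ℂ) * cbinom z n) ∧
      Summable (fun n : ℕ => (-1 : ℂ) ^ n * (a n : ℂ) * cbinom z (n + 1)) := by
  obtain ⟨s, hs1, hs2⟩ := exists_between hε
  obtain ⟨K, hK, hb⟩ := norm_cbinom_le (by linarith : (0 : ℝ) ≤ s) hs2
  have hsum : Summable fun n : ℕ => C * K * (n + 1 : ℝ) ^ (ε - 1 - s) := by
    refine Summable.mul_left _ ?_
    have := (summable_nat_add_iff 1).2 (Real.summable_nat_rpow.2 (by linarith : ε - 1 - s < -1))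
    simpa using this
  have hle : ∀ n : ℕ, |a n| * (K * (n + 1 : ℝ) ^ (-s)) ≤ C * K * (n + 1 : ℝ) ^ (ε - 1 - s) := by
    intro n
    have hpos : (0 : ℝ) < n + 1 := by positivity
    calc _ ≤ C * (n + 1 : ℝ) ^ (ε - 1) * (K * (n + 1 : ℝ) ^ (-s)) := by
          gcongr
          exact ha n
      _ = C * K * ((n + 1 : ℝ) ^ (ε - 1) * (n + 1 : ℝ) ^ (-s)) := by ring
      _ = _ := by rw [← Real.rpow_add hpos, sub_eq_add_neg _ s]
  constructor
  · refine Summable.of_norm_bounded hsum fun n => ?_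
    simp only [norm_mul, norm_pow, norm_neg, norm_one, one_pow, one_mul, Complex.norm_real,
      Real.norm_eq_abs]
    exact (mul_le_mul_of_nonneg_left (hb n) (abs_nonneg _)).trans (hle n)
  · refine Summable.of_norm_bounded hsum fun n => ?_
    simp only [norm_mul, norm_pow, norm_neg, norm_one, one_pow, one_mul, Complex.norm_real,
      Real.norm_eq_abs]
    refine (mul_le_mul_of_nonneg_left ((hb (n + 1)).trans ?_) (abs_nonneg _)).trans (hle n)
    gcongr ?_ * ?_
    refine Real.rpow_le_rpow_of_nonpos (by positivity) ?_ (by linarith)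
    push_cast
    linarith

/-- The Newton series `Σ_{n ≥ 1} (-1)^{n-1} a_{n-1} binom(z, n)`. -/
noncomputable def newton (a : ℕ → ℝ) (z : ℂ) : ℂ :=
  ∑' n : ℕ, (-1 : ℂ) ^ n * (a n : ℂ) * cbinom z (n + 1)

theorem newton_zero (a : ℕ → ℝ) : newton a 0 = 0 := by
  simp [newton, cbinom_zero_succ]

theorem table_col_le (w : List Bool) {ε : ℝ} (hε : 0 < ε) :
    ∃ C, 0 ≤ C ∧ ∀ m n : ℕ, |table w n m| ≤ C * (n + 1 : ℝ) ^ (ε - 1) := by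
  obtain ⟨C, hC, h⟩ := table_zero_le (w.map not) hε
  refine ⟨C, hC, fun m n => ?_⟩
  rw [abs_of_nonneg (table_nonneg w n m)]
  have := h n
  rw [table_map_not] at this
  exact (table_le_left w n m).trans this

theorem summable_newton_table (w : List Bool) (m : ℕ) {z : ℂ} (hz : -1 < z.re) :
    Summable (fun n : ℕ => (-1 : ℂ) ^ n * (table w n m : ℂ) * cbinom z n) ∧
      Summable (fun n : ℕ => (-1 : ℂ) ^ n * (table w n m : ℂ) * cbinom z (n + 1)) := by
  obtain ⟨C, -, h⟩ := table_col_le w (ε := (1 + z.re) / 2) (by linarith)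
  exact summable_newton (by linarith) (by linarith) (h m)

theorem newton_table_succ (w : List Bool) (m : ℕ) {z : ℂ} (hz : -1 < z.re) :
    newton (fun n => table w n m) (z + 1) =
      newton (fun n => table w n (m + 1)) z + table w 0 m := by
  obtain ⟨s1, s2⟩ := summable_newton_table w m hz
  have s3 := (summable_newton_table w (m + 1) hz).2
  have e1 : newton (fun n => table w n m) (z + 1) =
      (∑' n : ℕ, (-1 : ℂ) ^ n * (table w n m : ℂ) * cbinom z n) +
        newton (fun n => table w n m) z := by
    rw [newton, newton, ← s1.tsum_add s2]
    refine tsum_congr fun n => ?_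
    rw [cbinom_pascal, add_sub_cancel_right]
    ring
  have e2 : (∑' n : ℕ, (-1 : ℂ) ^ n * (table w n m : ℂ) * cbinom z n) =
      table w 0 m + (newton (fun n => table w n (m + 1)) z - newton (fun n => table w n m) z) := by
    rw [s1.tsum_eq_zero_add, newton, newton, ← s3.tsum_sub s2]
    congr 1
    · simp [cbinom_zero]
    · refine tsum_congr fun n => ?_
      rw [← table_pascal w n m]
      push_cast
      ring
  rw [e1, e2]
  ring

theorem newton_table_add_nat (w : List Bool) (N : ℕ) {z : ℂ} (hz : -1 < z.re) :
    newton (fun n => table w n 0) (z + N) =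
      newton (fun n => table w n N) z + ∑ i ∈ Finset.range N, (table w 0 i : ℂ) := by
  induction N generalizing z with
  | zero => simp
  | succ N ih =>
    have hz' : -1 < (z + 1).re := by simp; linarith
    have e : z + ((N + 1 : ℕ) : ℂ) = (z + 1) + N := by push_cast; ring
    rw [e, ih hz', newton_table_succ w N hz, Finset.sum_range_succ]
    ring

theorem newton_table_nat (w : List Bool) (N : ℕ) :
    newton (fun n => table w n 0) N = ∑ i ∈ Finset.range N, (table w 0 i : ℂ) := by
  simpa [newton_zero] using newton_table_add_nat w N (z := 0) (by simp)

theorem norm_newton_table_le (w : List Bool) {z : ℂ} (hz : -1 < z.re) :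
    ∃ δ : ℝ, 0 < δ ∧ ∃ C : ℝ, ∀ N : ℕ,
      ‖newton (fun n => table w n N) z‖ ≤ C * (N + 1 : ℝ) ^ (-δ) := by
  obtain ⟨δ, hδ0, hδ⟩ := exists_between (show 0 < min (1 / 2) ((1 + z.re) / 2) from
    lt_min (by norm_num) (by linarith))
  have hδ1 : δ < 1 / 2 := hδ.trans_le (min_le_left _ _)
  have hδ2 : 2 * δ < 1 + z.re := by linarith [hδ.trans_le (min_le_right _ _)]
  obtain ⟨C₁, hC₁, h₁⟩ := table_col_le w hδ0
  obtain ⟨C₂, hC₂, h₂⟩ := table_zero_le w hδ0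
  set K := max C₁ C₂
  have hK : 0 ≤ K := le_max_of_le_left hC₁
  have key : ∀ N n : ℕ, table w n N ≤ K * ((n + 1 : ℝ) ^ (2 * δ - 1) * (N + 1 : ℝ) ^ (-δ)) := by
    intro N n
    have hn : (0 : ℝ) < n + 1 := by positivity
    have hN : (0 : ℝ) < N + 1 := by positivity
    rcases le_total N n with h | h
    · have h' : (N + 1 : ℝ) ≤ n + 1 := by exact_mod_cast Nat.succ_le_succ h
      calc table w n N ≤ C₁ * (n + 1 : ℝ) ^ (δ - 1) := (le_abs_self _).trans (h₁ N n)
        _ = C₁ * ((n + 1 : ℝ) ^ (2 * δ - 1) * (n + 1 : ℝ) ^ (-δ)) := by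
            rw [← Real.rpow_add hn]; ring_nf
        _ ≤ _ := by
            have := Real.rpow_le_rpow_of_nonpos hN h' (neg_nonpos.2 hδ0.le)
            gcongr ?_ * (_ * ?_)
            exact le_max_left _ _
    · have h' : (n + 1 : ℝ) ≤ N + 1 := by exact_mod_cast Nat.succ_le_succ h
      calc table w n N ≤ C₂ * (N + 1 : ℝ) ^ (δ - 1) := (table_le_right w n N).trans (h₂ N)
        _ = C₂ * ((N + 1 : ℝ) ^ (2 * δ - 1) * (N + 1 : ℝ) ^ (-δ)) := by
            rw [← Real.rpow_add hN]; ring_nf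
        _ ≤ _ := by
            have := Real.rpow_le_rpow_of_nonpos hn h' (by linarith : 2 * δ - 1 ≤ 0)
            gcongr ?_ * (?_ * _)
            exact le_max_right _ _
  have hs := (summable_newton (a := fun n : ℕ => (n + 1 : ℝ) ^ (2 * δ - 1)) (C := 1)
    (by linarith : 0 ≤ 2 * δ) hδ2
    (fun n => by rw [one_mul, abs_of_nonneg (by positivity)])).2.norm
  refine ⟨δ, hδ0, _, fun N => tsum_of_norm_bounded ((hs.hasSum.mul_left K).mul_right _) fun n => ?_⟩
  simp only [norm_mul, norm_pow, norm_neg, norm_one, one_pow, one_mul, Complex.norm_real,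
    Real.norm_eq_abs]
  rw [abs_of_nonneg (table_nonneg w n N),
    abs_of_nonneg (by positivity : 0 ≤ (n + 1 : ℝ) ^ (2 * δ - 1))]
  calc _ ≤ K * ((n + 1 : ℝ) ^ (2 * δ - 1) * (N + 1 : ℝ) ^ (-δ)) * ‖cbinom z (n + 1)‖ := by
        gcongr
        exact key N n
    _ = _ := by ring

theorem newton_sub_newton (w : List Bool) {z : ℂ} (hz : 0 < z.re) :
    newton (fun n => table w n 0) z - newton (fun n => table w n 0) (z - 1) =
      ∑' n : ℕ, (-1 : ℂ) ^ n * (table w n 0 : ℂ) * cbinom (z - 1) n := by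
  have hz1 : -1 < (z - 1).re := by simp; linarith
  rw [newton, newton, ← (summable_newton_table w 0 (by linarith)).2.tsum_sub
    (summable_newton_table w 0 hz1).2]
  refine tsum_congr fun n => ?_
  rw [cbinom_pascal]
  ring

theorem mul_newton_sub_newton (w : List Bool) {z : ℂ} (hz : 0 < z.re) :
    HasSum (fun n : ℕ => (-1 : ℂ) ^ n * ((n + 1) * table w n 0 : ℂ) * cbinom z (n + 1))
      (z * (newton (fun n => table w n 0) z - newton (fun n => table w n 0) (z - 1))) := by
  have hz1 : -1 < (z - 1).re := by simp; linarith
  rw [newton_sub_newton w hz]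
  have e : (fun n : ℕ => (-1 : ℂ) ^ n * ((n + 1) * table w n 0 : ℂ) * cbinom z (n + 1)) =
      fun n : ℕ => z * ((-1) ^ n * (table w n 0 : ℂ) * cbinom (z - 1) n) := by
    funext n
    linear_combination -((-1) ^ n * (table w n 0 : ℂ)) * mul_cbinom_sub_one z n
  rw [e]
  exact (summable_newton_table w 0 hz1).1.hasSum.mul_left z

theorem mul_newton_sub_newton_false (w : List Bool) {z : ℂ} (hz : 0 < z.re) :
    z * (newton (fun n => table (false :: w) n 0) z -
      newton (fun n => table (false :: w) n 0) (z - 1)) = newton (fun n => table w n 0) z := by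
  rw [← (mul_newton_sub_newton (false :: w) hz).tsum_eq, newton]
  refine tsum_congr fun n => ?_
  have h : (n + 1 : ℝ) * table (false :: w) n 0 = table w n 0 := by
    have hpos : (n + 1 : ℝ) ≠ 0 := by positivity
    simp only [table, divTable]
    field_simp
  rw [← h]
  push_cast
  ring

theorem tendsto_rpow_neg_nat {δ : ℝ} (hδ : 0 < δ) :
    Tendsto (fun N : ℕ => (N + 1 : ℝ) ^ (-δ)) atTop (𝓝 0) := by
  have := (tendsto_rpow_neg_atTop hδ).comp
    (tendsto_natCast_atTop_atTop.comp (tendsto_add_atTop_nat 1))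
  refine this.congr fun n => ?_
  simp

theorem tendsto_mul_cbinom (w : List Bool) {z : ℂ} (hz : 0 < z.re) :
    Tendsto (fun n : ℕ => (n : ℂ) * table w (n - 1) 0 * cbinom (z - 1) n) atTop (𝓝 0) := by
  rw [← tendsto_add_atTop_iff_nat 1]
  obtain ⟨s, hs0, hs⟩ := exists_between hz
  obtain ⟨K, hK, hb⟩ := norm_cbinom_le (z := z - 1) hs0.le (by simpa using hs)
  obtain ⟨C, hC, h⟩ := table_col_le w (ε := s / 2) (by linarith)
  refine squeeze_zero_norm (a := fun n : ℕ => C * K * (n + 1 : ℝ) ^ (-(s / 2))) (fun n => ?_) ?_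
  · have hn : (0 : ℝ) < n + 1 := by positivity
    have hb' : ‖cbinom (z - 1) (n + 1)‖ ≤ K * (n + 1 : ℝ) ^ (-s) := by
      refine (hb (n + 1)).trans ?_
      gcongr ?_ * ?_
      refine Real.rpow_le_rpow_of_nonpos (by positivity) ?_ (by linarith)
      push_cast
      linarith
    rw [norm_mul, norm_mul, Complex.norm_natCast, Complex.norm_real, Real.norm_eq_abs]
    calc _ ≤ ((n + 1 : ℕ) : ℝ) * (C * (n + 1 : ℝ) ^ (s / 2 - 1)) * (K * (n + 1 : ℝ) ^ (-s)) := by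
          gcongr
          exact h 0 n
      _ = C * K * ((n + 1 : ℝ) ^ (s / 2) * (n + 1 : ℝ) ^ (-s)) := by
          rw [Real.rpow_sub_one hn.ne']
          push_cast
          field_simp
      _ = _ := by
          rw [← Real.rpow_add hn]
          ring_nf
  · simpa using (tendsto_rpow_neg_nat (half_pos hs0)).const_mul (C * K)

theorem mul_newton_sub_newton_true (w : List Bool) {z : ℂ} (hz : 0 < z.re) :
    z * (newton (fun n => table (true :: w) n 0) z -
      newton (fun n => table (true :: w) n 0) (z - 1)) =
    newton (fun n => table w n 0) z - newton (fun n => table w n 0) (z - 1) := by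
  have hz1 : -1 < (z - 1).re := by simp; linarith
  have h1 := (mul_newton_sub_newton (true :: w) hz).tendsto_sum_nat
  have h2 := (summable_newton_table w 0 hz1).1.hasSum.tendsto_sum_nat
  rw [← newton_sub_newton w hz] at h2
  refine eq_of_sub_eq_zero (tendsto_nhds_unique (h1.sub h2) ?_)
  have ht : ∀ n : ℕ, (n + 1 : ℂ) * table (true :: w) n 0 =
      table w n 0 + n * table (true :: w) (n - 1) 0 := by
    rintro (_ | n)
    · simp [table, divTable]
    · have h : (n + 2 : ℝ) * table (true :: w) (n + 1) 0 =
          table w (n + 1) 0 + (n + 1) * table (true :: w) n 0 := by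
        simp only [table, divTable]
        push_cast
        field_simp
        ring
      have h' := congrArg (fun x : ℝ => (x : ℂ)) h
      push_cast at h' ⊢
      linear_combination h'
  have key : ∀ n : ℕ, (∑ i ∈ Finset.range n,
      (-1 : ℂ) ^ i * ((i + 1) * table (true :: w) i 0 : ℂ) * cbinom z (i + 1)) -
      ∑ i ∈ Finset.range n, (-1 : ℂ) ^ i * (table w i 0 : ℂ) * cbinom (z - 1) i =
        -((-1) ^ n * ((n : ℂ) * table (true :: w) (n - 1) 0 * cbinom (z - 1) n)) := by
    intro n
    induction n with
    | zero => simp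
    | succ n ih =>
      rw [Finset.sum_range_succ, Finset.sum_range_succ, cbinom_pascal, Nat.add_sub_cancel]
      push_cast
      linear_combination ih + (-1) ^ n * cbinom (z - 1) n * ht n
  refine squeeze_zero_norm (fun n => le_of_eq ?_)
    (by simpa using (tendsto_mul_cbinom (true :: w) hz).norm)
  rw [key]
  simp

theorem mul_newton_sub_newton_nil {z : ℂ} (hz : 0 < z.re) :
    z * (newton (fun n => table [] n 0) z - newton (fun n => table [] n 0) (z - 1)) = 1 := by
  have h1 := (mul_newton_sub_newton [] hz).tendsto_sum_nat
  refine eq_of_sub_eq_zero (tendsto_nhds_unique (h1.sub_const 1) ?_)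
  obtain ⟨s, hs0, hs⟩ := exists_between hz
  obtain ⟨K, hK, hb⟩ := norm_cbinom_le (z := z - 1) hs0.le (by simpa using hs)
  refine squeeze_zero_norm (fun n => ?_)
    (by simpa using (tendsto_rpow_neg_nat hs0).const_mul K)
  refine le_of_eq_of_le ?_ (hb n)
  have ht : ∀ n : ℕ, (n + 1 : ℂ) * table [] n 0 = 1 := fun n => by
    have h := table_map_not [] 0 n
    rw [List.map_nil, table_nil_zero] at h
    have h' : (n + 1 : ℂ) ≠ 0 := by exact_mod_cast n.succ_ne_zero
    rw [← h]
    push_cast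
    field_simp
  have key : ∀ n : ℕ, ∑ i ∈ Finset.range n,
      (-1 : ℂ) ^ i * ((i + 1) * table [] i 0 : ℂ) * cbinom z (i + 1) =
        1 - (-1) ^ n * cbinom (z - 1) n := by
    intro n
    induction n with
    | zero => simp [cbinom_zero]
    | succ n ih =>
      rw [Finset.sum_range_succ, ih, ht, cbinom_pascal]
      ring
  rw [key]
  simp

/-- The Kawashima function of a reversed index. -/
noncomputable def revF (j : List ℕ) (z : ℂ) : ℂ := F j.reverse z

theorem revF_nil (z : ℂ) : revF [] z = 1 := by simp [revF, F]

theorem revF_ofWord (w : List Bool) (z : ℂ) :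
    revF (ofWord w) z = newton (fun n => table w n 0) z := by
  obtain ⟨a, j, h⟩ := exists_ofWord_eq_cons w
  have hne : (ofWord w).reverse ≠ [] := by simp [h]
  simp only [revF, F, if_neg hne, sStar_hdual_ofWord, newton]

theorem exists_ofWord_newton_sub (a : ℕ) {j : List ℕ} (hj : ∀ x ∈ j, 0 < x) :
    ∃ w, ofWord w = (a + 1) :: j ∧ ∀ z : ℂ, 0 < z.re →
      newton (fun n => table w n 0) z - newton (fun n => table w n 0) (z - 1) =
        revF j z / z ^ (a + 1) := by
  have hz0 : ∀ z : ℂ, 0 < z.re → z ≠ 0 := by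
    rintro z hz rfl
    simp at hz
  induction a with
  | zero =>
    by_cases hne : j = []
    · refine ⟨[], by simp [ofWord, hne], fun z hz => ?_⟩
      rw [hne, revF_nil, zero_add, pow_one, eq_div_iff (hz0 z hz), mul_comm,
        mul_newton_sub_newton_nil hz]
    · obtain ⟨w, rfl⟩ := exists_ofWord_eq hne hj
      refine ⟨false :: w, rfl, fun z hz => ?_⟩
      rw [revF_ofWord, zero_add, pow_one, eq_div_iff (hz0 z hz), mul_comm,
        mul_newton_sub_newton_false w hz]
  | succ a ih =>
    obtain ⟨w, hw, h⟩ := ih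
    refine ⟨true :: w, ofWord_true hw, fun z hz => ?_⟩
    rw [pow_succ, ← div_div, ← h z hz, eq_div_iff (hz0 z hz), mul_comm,
      mul_newton_sub_newton_true w hz]

theorem revF_sub_revF {a : ℕ} {j : List ℕ} (ha : 0 < a) (hj : ∀ x ∈ j, 0 < x) {z : ℂ}
    (hz : 0 < z.re) : revF (a :: j) z - revF (a :: j) (z - 1) = revF j z / z ^ a := by
  obtain ⟨b, rfl⟩ : ∃ b, a = b + 1 := ⟨a - 1, by omega⟩
  obtain ⟨w, hw, h⟩ := exists_ofWord_newton_sub b hj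
  rw [← hw, revF_ofWord, revF_ofWord, h z hz]

theorem revF_cons_zero {a : ℕ} {j : List ℕ} (ha : 0 < a) (hj : ∀ x ∈ j, 0 < x) :
    revF (a :: j) 0 = 0 := by
  obtain ⟨w, hw⟩ := exists_ofWord_eq (List.cons_ne_nil a j) (by simpa using ⟨ha, hj⟩)
  rw [← hw, revF_ofWord, newton_zero]

theorem norm_revF_nat_le {j : List ℕ} (hj : ∀ x ∈ j, 0 < x) {ε : ℝ} (hε : 0 < ε) :
    ∃ C, 0 ≤ C ∧ ∀ N : ℕ, ‖revF j N‖ ≤ C * (N + 1 : ℝ) ^ ε := by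
  by_cases hne : j = []
  · refine ⟨1, zero_le_one, fun N => ?_⟩
    rw [hne, revF_nil, norm_one, one_mul]
    exact Real.one_le_rpow (by linarith [N.cast_nonneg (α := ℝ)]) hε.le
  · obtain ⟨w, rfl⟩ := exists_ofWord_eq hne hj
    obtain ⟨C, hC, h⟩ := sum_table_zero_le w hε
    refine ⟨C, hC, fun N => ?_⟩
    rw [revF_ofWord, newton_table_nat, ← Complex.ofReal_sum, Complex.norm_real, Real.norm_eq_abs,
      abs_of_nonneg (Finset.sum_nonneg fun i _ => table_nonneg w 0 i)]
    exact h N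

theorem norm_revF_add_nat_sub_le {j : List ℕ} (hj : ∀ x ∈ j, 0 < x) {z : ℂ} (hz : -1 < z.re) :
    ∃ δ : ℝ, 0 < δ ∧ ∃ C : ℝ, ∀ N : ℕ, ‖revF j (z + N) - revF j N‖ ≤ C * (N + 1 : ℝ) ^ (-δ) := by
  by_cases hne : j = []
  · exact ⟨1, one_pos, 0, fun N => by simp [hne, revF_nil]⟩
  · obtain ⟨w, rfl⟩ := exists_ofWord_eq hne hj
    obtain ⟨δ, hδ, C, h⟩ := norm_newton_table_le w hz
    refine ⟨δ, hδ, C, fun N => ?_⟩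
    rw [revF_ofWord, revF_ofWord, newton_table_nat, newton_table_add_nat w N hz,
      add_sub_cancel_right]
    exact h N

theorem tendsto_revF_add_nat_sub {j : List ℕ} (hj : ∀ x ∈ j, 0 < x) {z : ℂ} (hz : -1 < z.re) :
    Tendsto (fun N : ℕ => revF j (z + N) - revF j N) atTop (𝓝 0) := by
  obtain ⟨δ, hδ, C, h⟩ := norm_revF_add_nat_sub_le hj hz
  exact squeeze_zero_norm h (by simpa using (tendsto_rpow_neg_nat hδ).const_mul C)

theorem tendsto_revF_mul_sub {i j : List ℕ} (hi : ∀ x ∈ i, 0 < x) (hj : ∀ x ∈ j, 0 < x) {z : ℂ}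
    (hz : -1 < z.re) :
    Tendsto (fun N : ℕ => revF i N * (revF j (z + N) - revF j N)) atTop (𝓝 0) := by
  obtain ⟨δ, hδ, C, h⟩ := norm_revF_add_nat_sub_le hj hz
  obtain ⟨K, hK, h'⟩ := norm_revF_nat_le hi (half_pos hδ)
  refine squeeze_zero_norm (a := fun N : ℕ => K * C * (N + 1 : ℝ) ^ (-(δ / 2))) (fun N => ?_)
    (by simpa using (tendsto_rpow_neg_nat (half_pos hδ)).const_mul (K * C))
  have hN : (0 : ℝ) < N + 1 := by positivity
  rw [norm_mul]
  calc _ ≤ K * (N + 1 : ℝ) ^ (δ / 2) * (C * (N + 1 : ℝ) ^ (-δ)) := by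
        gcongr
        · exact h' N
        · exact h N
    _ = K * C * ((N + 1 : ℝ) ^ (δ / 2) * (N + 1 : ℝ) ^ (-δ)) := by ring
    _ = _ := by
        rw [← Real.rpow_add hN]
        ring_nf

theorem tendsto_revF_mul_revF {i j : List ℕ} (hi : ∀ x ∈ i, 0 < x) (hj : ∀ x ∈ j, 0 < x) {z : ℂ}
    (hz : -1 < z.re) :
    Tendsto (fun N : ℕ => revF i (z + N) * revF j (z + N) - revF i N * revF j N)
      atTop (𝓝 0) := by
  have h := ((tendsto_revF_mul_sub hi hj hz).add (tendsto_revF_mul_sub hj hi hz)).add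
    ((tendsto_revF_add_nat_sub hi hz).mul (tendsto_revF_add_nat_sub hj hz))
  simp only [mul_zero, add_zero] at h
  refine h.congr fun N => ?_
  ring

/-- `revF` extended `ℚ`-linearly to formal combinations of reversed indices. -/
noncomputable def revFL (v : List ℕ →₀ ℚ) (z : ℂ) : ℂ :=
  v.sum fun j c => (c : ℂ) * revF j z

theorem FL_mapDomain_reverse (v : List ℕ →₀ ℚ) (z : ℂ) :
    FL (Finsupp.mapDomain List.reverse v) z = revFL v z := by
  rw [FL, Finsupp.sum_mapDomain_index (by simp) (by intros; push_cast; ring)]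
  rfl

theorem revFL_add (v v' : List ℕ →₀ ℚ) (z : ℂ) : revFL (v + v') z = revFL v z + revFL v' z :=
  Finsupp.sum_add_index' (by simp) (by intros; push_cast; ring)

theorem revFL_sub (v v' : List ℕ →₀ ℚ) (z : ℂ) : revFL (v - v') z = revFL v z - revFL v' z :=
  Finsupp.sum_sub_index (by intros; push_cast; ring)

theorem revFL_single (j : List ℕ) (z : ℂ) : revFL (Finsupp.single j 1) z = revF j z := by
  simp [revFL]

theorem revFL_mapDomain_cons (a : ℕ) (v : List ℕ →₀ ℚ) (z : ℂ) :
    revFL (Finsupp.mapDomain (List.cons a) v) z = v.sum fun j c => (c : ℂ) * revF (a :: j) z :=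
  Finsupp.sum_mapDomain_index (by simp) (by intros; push_cast; ring)

/-- All indices occurring in the formal combination have positive entries. -/
def IsPositive (v : List ℕ →₀ ℚ) : Prop := ∀ j ∈ v.support, ∀ x ∈ j, 0 < x

theorem IsPositive.single {j : List ℕ} (hj : ∀ x ∈ j, 0 < x) :
    IsPositive (Finsupp.single j 1) := by
  intro i hi
  rw [Finset.mem_singleton.1 (Finsupp.support_single_subset hi)]
  exact hj

theorem IsPositive.add {v v' : List ℕ →₀ ℚ} (h : IsPositive v) (h' : IsPositive v') :
    IsPositive (v + v') := fun j hj =>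
  (Finset.mem_union.1 (Finsupp.support_add hj)).elim (h j) (h' j)

theorem IsPositive.sub {v v' : List ℕ →₀ ℚ} (h : IsPositive v) (h' : IsPositive v') :
    IsPositive (v - v') := fun j hj =>
  (Finset.mem_union.1 (Finsupp.support_sub hj)).elim (h j) (h' j)

theorem IsPositive.mapDomain_cons {v : List ℕ →₀ ℚ} (h : IsPositive v) {a : ℕ} (ha : 0 < a) :
    IsPositive (Finsupp.mapDomain (List.cons a) v) := by
  intro j hj
  obtain ⟨i, hi, rfl⟩ := Finset.mem_image.1 (Finsupp.mapDomain_support hj)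
  simpa using ⟨ha, h i hi⟩

theorem isPositive_hbarAux (k l : List ℕ) (hk : ∀ x ∈ k, 0 < x) (hl : ∀ x ∈ l, 0 < x) :
    IsPositive (hbarAux k l) := by
  induction k, l using hbarAux.induct with
  | case1 l => rw [hbarAux]; exact .single hl
  | case2 a k => rw [hbarAux]; exact .single hk
  | case3 a k b l ih1 ih2 ih3 =>
    rw [hbarAux]
    have hk' := List.forall_mem_cons.1 hk
    have hl' := List.forall_mem_cons.1 hl
    exact (((ih1 hk'.2 hl).mapDomain_cons hk'.1).add ((ih2 hk hl'.2).mapDomain_cons hl'.1)).sub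
      ((ih3 hk'.2 hl'.2).mapDomain_cons (Nat.add_pos_left hk'.1 b))

theorem revFL_mapDomain_cons_sub {a : ℕ} (ha : 0 < a) {v : List ℕ →₀ ℚ} (hv : IsPositive v)
    {z : ℂ} (hz : 0 < z.re) :
    revFL (Finsupp.mapDomain (List.cons a) v) z -
      revFL (Finsupp.mapDomain (List.cons a) v) (z - 1) = revFL v z / z ^ a := by
  rw [revFL_mapDomain_cons, revFL_mapDomain_cons, revFL, Finsupp.sum, Finsupp.sum, Finsupp.sum,
    ← Finset.sum_sub_distrib, Finset.sum_div]
  refine Finset.sum_congr rfl fun j hj => ?_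
  rw [← mul_sub, revF_sub_revF ha (hv j hj) hz, mul_div_assoc]

theorem revFL_mapDomain_cons_zero {a : ℕ} (ha : 0 < a) {v : List ℕ →₀ ℚ} (hv : IsPositive v) :
    revFL (Finsupp.mapDomain (List.cons a) v) 0 = 0 := by
  rw [revFL_mapDomain_cons]
  exact Finset.sum_eq_zero fun j hj => by
    simp only [revF_cons_zero ha (hv j hj), mul_zero]

theorem tendsto_revFL_add_nat_sub {v : List ℕ →₀ ℚ} (hv : IsPositive v) {z : ℂ}
    (hz : -1 < z.re) :
    Tendsto (fun N : ℕ => revFL v (z + N) - revFL v N) atTop (𝓝 0) := by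
  have h := tendsto_finsetSum v.support fun j hj =>
    (tendsto_revF_add_nat_sub (hv j hj) hz).const_mul (v j : ℂ)
  simp only [mul_zero, Finset.sum_const_zero] at h
  refine h.congr fun N => ?_
  simp only [revFL, Finsupp.sum, mul_sub, Finset.sum_sub_distrib]

/-- A function on `Re z > -1` that is `1`-periodic, vanishes at `0` and satisfies
`D (z + N) - D N → 0` is zero. -/
theorem eq_zero_of_periodic {D : ℂ → ℂ} (h0 : D 0 = 0)
    (hper : ∀ z : ℂ, 0 < z.re → D z = D (z - 1)) {z : ℂ} (hz : -1 < z.re)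
    (hlim : Tendsto (fun N : ℕ => D (z + N) - D N) atTop (𝓝 0)) : D z = 0 := by
  have key : ∀ (N : ℕ) (y : ℂ), -1 < y.re → D (y + N) = D y := by
    intro N y hy
    induction N with
    | zero => simp
    | succ N ih =>
      rw [← ih, hper _ (by simp; linarith [N.cast_nonneg (α := ℝ)])]
      congr 1
      push_cast
      ring
  refine tendsto_nhds_unique (tendsto_const_nhds.congr fun N => ?_) hlim
  have hN := key N 0 (by simp)
  rw [zero_add] at hN
  rw [key N z hz, hN, h0, sub_zero]

theorem revF_mul_revF (k l : List ℕ) (hk : ∀ x ∈ k, 0 < x) (hl : ∀ x ∈ l, 0 < x) {z : ℂ}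
    (hz : -1 < z.re) : revF k z * revF l z = revFL (hbarAux k l) z := by
  induction k, l using hbarAux.induct generalizing z with
  | case1 l => rw [hbarAux, revFL_single, revF_nil, one_mul]
  | case2 a k => rw [hbarAux, revFL_single, revF_nil, mul_one]
  | case3 a k b l ih1 ih2 ih3 =>
    obtain ⟨ha, hk'⟩ := List.forall_mem_cons.1 hk
    obtain ⟨hb, hl'⟩ := List.forall_mem_cons.1 hl
    have hab := Nat.add_pos_left ha b
    have p1 := isPositive_hbarAux k (b :: l) hk' hl
    have p2 := isPositive_hbarAux (a :: k) l hk hl'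
    have p3 := isPositive_hbarAux k l hk' hl'
    have p := isPositive_hbarAux (a :: k) (b :: l) hk hl
    have expand : ∀ y, revFL (hbarAux (a :: k) (b :: l)) y =
        revFL (Finsupp.mapDomain (List.cons a) (hbarAux k (b :: l))) y +
        revFL (Finsupp.mapDomain (List.cons b) (hbarAux (a :: k) l)) y -
        revFL (Finsupp.mapDomain (List.cons (a + b)) (hbarAux k l)) y := fun y => by
      rw [hbarAux, revFL_sub, revFL_add]
    refine sub_eq_zero.1 (eq_zero_of_periodic
      (D := fun y => revF (a :: k) y * revF (b :: l) y - revFL (hbarAux (a :: k) (b :: l)) y)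
      ?_ (fun y hy => ?_) hz ?_)
    · simp only [expand, revF_cons_zero ha hk', revFL_mapDomain_cons_zero ha p1,
        revFL_mapDomain_cons_zero hb p2, revFL_mapDomain_cons_zero hab p3]
      simp
    · have hy1 : -1 < y.re := by linarith
      have d1 := revFL_mapDomain_cons_sub ha p1 hy
      have d2 := revFL_mapDomain_cons_sub hb p2 hy
      have d3 := revFL_mapDomain_cons_sub hab p3 hy
      rw [← ih1 hk' hl hy1] at d1
      rw [← ih2 hk hl' hy1] at d2
      rw [← ih3 hk' hl' hy1] at d3
      have f1 := revF_sub_revF ha hk' hy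
      have f2 := revF_sub_revF hb hl' hy
      have e3 : revF k y * revF l y / y ^ (a + b) = revF k y / y ^ a * (revF l y / y ^ b) := by
        rw [pow_add, div_mul_div_comm]
      rw [e3, ← f1, ← f2] at d3
      rw [mul_div_right_comm, ← f1] at d1
      rw [mul_div_assoc, ← f2] at d2
      simp only [expand]
      linear_combination d3 - d1 - d2
    · have h := (tendsto_revF_mul_revF hk hl hz).sub (tendsto_revFL_add_nat_sub p hz)
      rw [sub_zero] at h
      refine h.congr fun N => ?_
      ring

/-- Harmonic relation for Kawashima functions:
`F_k(z) · F_l(z) = F_{k *̄ l}(z)` for `Re(z) > -1`. -/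
theorem F_harmonic_relation (k l : List ℕ)
    (hk : ∀ x ∈ k, 0 < x) (hl : ∀ x ∈ l, 0 < x)
    (z : ℂ) (hz : -1 < z.re) :
    F k z * F l z = FL (hbar k l) z := by
  rw [hbar, FL_mapDomain_reverse, ← revF_mul_revF _ _ (by simpa using hk) (by simpa using hl) hz]
  simp [revF]

end Kawashima
end
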